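/- arXiv:2105.13874 — 2 statements merged into one kernel-verified Lean document; each statement's English description precedes it below -/
import Mathlib

section
/- Let A ⊆ H be an affine commutative-by-finite Hopf algebra. Then the tangential component W(H°) := {f ∈ H° : f((A⁺H)ⁿ) = 0 for some n > 0} is a normal Hopf subalgebra of H° (stable under both adjoint actions of H°), and H̄* is a normal Hopf subalgebra of W(H°). -/
open TensorProduct LinearMap Coalgebra

namespace Paper

noncomputable section

variable (k : Type) [Field k]

section Coalg

variable {C : Type} [AddCommMonoid C] [Module k C] [Coalgebra k C]

/-- Convolution product on the linear dual of a coalgebra. -/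
noncomputable def conv (f g : Module.Dual k C) : Module.Dual k C :=
  (TensorProduct.lid k k).toLinearMap ∘ₗ TensorProduct.map f g ∘ₗ Coalgebra.comul

/-- The unit of the convolution algebra on the dual: the counit. -/
noncomputable def convOne : Module.Dual k C := Coalgebra.counit

/-- Iterated convolution power. -/
noncomputable def convPow (f : Module.Dual k C) : ℕ → Module.Dual k C
  | 0 => convOne k
  | n + 1 => conv k f (convPow f n)

end Coalg

/-- The finite dual of an algebra: functionals vanishing on a two-sided ideal
of finite codimension. -/
def finDual (H : Type) [Ring H] [Algebra k H] : Set (Module.Dual k H) :=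
  {f | ∃ I : Submodule k H, (∀ (h : H), ∀ x ∈ I, h * x ∈ I ∧ x * h ∈ I) ∧
    I ≤ LinearMap.ker f ∧ FiniteDimensional k (H ⧸ I)}

section Hopf

variable (H : Type) [Ring H] [HopfAlgebra k H]

/-- Left adjoint action `(ad_ℓ h)(a) = Σ h₁ a S(h₂)`. -/
noncomputable def adl (h a : H) : H :=
  TensorProduct.lift (((LinearMap.mul k H).comp (LinearMap.mulRight k a)).compl₂
    (HopfAlgebra.antipode (R := k))) (Coalgebra.comul h)

/-- Right adjoint action `(ad_r h)(a) = Σ S(h₁) a h₂`. -/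
noncomputable def adr (h a : H) : H :=
  TensorProduct.lift ((LinearMap.mul k H).comp ((LinearMap.mulRight k a) ∘ₗ
    (HopfAlgebra.antipode (R := k)))) (Coalgebra.comul h)

/-- Left adjoint action on the dual: `(ad_ℓ φ)(f) = Σ φ₁ f S°(φ₂)`, i.e.
`h ↦ Σ φ(h₁ S(h₃)) f(h₂)`. -/
noncomputable def adld (φ f : Module.Dual k H) : Module.Dual k H :=
  (TensorProduct.lid k k).toLinearMap ∘ₗ
    TensorProduct.map (φ ∘ₗ LinearMap.mul' k H ∘ₗ
      (HopfAlgebra.antipode (R := k)).lTensor H) f ∘ₗ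
    (TensorProduct.assoc k H H H).symm.toLinearMap ∘ₗ
    ((TensorProduct.comm k H H).toLinearMap.lTensor H) ∘ₗ
    ((Coalgebra.comul (R := k) (A := H)).lTensor H) ∘ₗ
    Coalgebra.comul

/-- Right adjoint action on the dual: `(ad_r φ)(f) = Σ S°(φ₁) f φ₂`, i.e.
`h ↦ Σ φ(S(h₁) h₃) f(h₂)`. -/
noncomputable def adrd (φ f : Module.Dual k H) : Module.Dual k H :=
  (TensorProduct.lid k k).toLinearMap ∘ₗ
    TensorProduct.map (φ ∘ₗ LinearMap.mul' k H ∘ₗ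
      (HopfAlgebra.antipode (R := k)).rTensor H) f ∘ₗ
    (TensorProduct.assoc k H H H).symm.toLinearMap ∘ₗ
    ((TensorProduct.comm k H H).toLinearMap.lTensor H) ∘ₗ
    ((Coalgebra.comul (R := k) (A := H)).lTensor H) ∘ₗ
    Coalgebra.comul

/-- A submodule is a subcoalgebra if its image under `comul` lies in `V ⊗ V`. -/
def IsSubcoalgebra (V : Submodule k H) : Prop :=
  ∀ x ∈ V, Coalgebra.comul (R := k) x ∈
    LinearMap.range (TensorProduct.map V.subtype V.subtype)

/-- A Hopf algebra is pointed if every simple subcoalgebra is one-dimensional. -/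
def IsPointedHopf : Prop :=
  ∀ V : Submodule k H, IsSubcoalgebra k H V → V ≠ ⊥ →
    (∀ W : Submodule k H, W ≤ V → IsSubcoalgebra k H W → W = ⊥ ∨ W = V) →
    Module.finrank k ↥V = 1

/-- A coideal: `ε(X) = 0` and `Δ(X) ⊆ X ⊗ H + H ⊗ X`. -/
def IsCoideal (X : Submodule k H) : Prop :=
  (∀ x ∈ X, Coalgebra.counit (R := k) x = 0) ∧
  (∀ x ∈ X, Coalgebra.comul (R := k) x ∈
    LinearMap.range (TensorProduct.map X.subtype (LinearMap.id (M := H))) ⊔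
    LinearMap.range (TensorProduct.map (LinearMap.id (M := H)) X.subtype))

/-- `S` is a Hopf subalgebra of the finite dual `H°` (with its convolution
product; closure under the coproduct is expressed in pairing form). -/
def IsHopfSubalgSet (S : Set (Module.Dual k H)) : Prop :=
  S ⊆ finDual k H ∧ convOne k ∈ S ∧
  (∀ f g, f ∈ S → g ∈ S → f + g ∈ S ∧ conv k f g ∈ S) ∧
  (∀ (c : k), ∀ f ∈ S, c • f ∈ S) ∧
  (∀ f ∈ S, f ∘ₗ HopfAlgebra.antipode (R := k) ∈ S) ∧
  (∀ f ∈ S, ∃ (n : ℕ) (s t : Fin n → Module.Dual k H),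
    (∀ i, s i ∈ S ∧ t i ∈ S) ∧ ∀ x y : H, f (x * y) = ∑ i, s i x * t i y)

end Hopf

section Ext

variable (A : Type) [CommRing A] [HopfAlgebra k A]
variable (H : Type) [Ring H] [HopfAlgebra k H]

/-- The submodule `A⁺H` of `H` (image of the augmentation ideal times `H`). -/
def augHIdeal (ι : A →ₗ[k] H) : Submodule k H :=
  Submodule.span k
    {x : H | ∃ (a : A) (h : H), Coalgebra.counit (R := k) a = 0 ∧ x = ι a * h}

/-- The subset of the dual of `H` corresponding to `H̄* = (H/A⁺H)*`:
functionals vanishing on `A⁺H`. -/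
def hbarStar (ι : A →ₗ[k] H) : Set (Module.Dual k H) :=
  {f | ∀ x ∈ augHIdeal k A H ι, f x = 0}

/-- The tangential component `W(H°)`. -/
def tangential (ι : A →ₗ[k] H) : Set (Module.Dual k H) :=
  {f | f ∈ finDual k H ∧ ∃ n : ℕ, 0 < n ∧ ∀ x ∈ (augHIdeal k A H ι) ^ n, f x = 0}

/-- The augmentation ideal of the commutative Hopf algebra `A`. -/
def augIdeal : Ideal A := RingHom.ker (Bialgebra.counitAlgHom k A)

/-- The irreducible component `A'` of `A°` containing the counit:
functionals vanishing on a power of the augmentation ideal. -/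
def Aprime : Set (Module.Dual k A) :=
  {f | ∃ n : ℕ, 0 < n ∧ ∀ x ∈ (augIdeal k A) ^ n, f x = 0}

/-- The Lie algebra `𝔤` of `G_H`: primitive functionals on `A`. -/
def gLie : Set (Module.Dual k A) :=
  {f | f 1 = 0 ∧ ∀ x y : A, f (x * y) =
    f x * Coalgebra.counit (R := k) y + Coalgebra.counit (R := k) x * f y}

/-- An ideal of `A` is `H̄`-stable if it is stable under the (left) adjoint
action of `H` on `A` (which factors through `H̄`). -/
def IsHStable (ι : A →ₗ[k] H) (I : Ideal A) : Prop :=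
  ∀ (h : H), ∀ a ∈ I, ∃ b ∈ I, ι b = adl k H h (ι a)

/-- `mc` is the `H̄`-core of `m`: the largest `H̄`-stable ideal of `A`
contained in `m`. -/
def IsCore (ι : A →ₗ[k] H) (m mc : Ideal A) : Prop :=
  IsHStable k A H ι mc ∧ mc ≤ m ∧
    ∀ I : Ideal A, IsHStable k A H ι I → I ≤ m → I ≤ mc

/-- The submodule `H·J` of `H`, for an ideal `J` of `A`. -/
def leftMul (ι : A →ₗ[k] H) (J : Ideal A) : Submodule k H :=
  Submodule.span k {x : H | ∃ (h : H), ∃ a ∈ J, x = h * ι a}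

/-- The submodule `J·H` of `H`, for an ideal `J` of `A`. -/
def rightMul (ι : A →ₗ[k] H) (J : Ideal A) : Submodule k H :=
  Submodule.span k {x : H | ∃ (h : H), ∃ a ∈ J, x = ι a * h}

/-- The subcoalgebra `ĝ := (H/H m_g^{(H̄)})*` of `H°`, as a submodule of the dual. -/
def ghat (ι : A →ₗ[k] H) (core : Ideal A → Ideal A) (g : A →ₐ[k] k) :
    Submodule k (Module.Dual k H) :=
  (leftMul k A H ι (core (RingHom.ker g))).dualAnnihilator

/-- The character component `k̂G_H` of `H°`. -/
def charComp (ι : A →ₗ[k] H) (core : Ideal A → Ideal A) :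
    Set (Module.Dual k H) :=
  {f | ∃ s : Finset (A →ₐ[k] k), s.Nonempty ∧
    ∀ x ∈ ⨅ g ∈ s, leftMul k A H ι (core (RingHom.ker g)), f x = 0}

/-- Hypothesis (OrbSemi): all orbit algebras `A/m^{(H̄)}` are semisimple. -/
def OrbSemi (core : Ideal A → Ideal A) : Prop :=
  ∀ m : Ideal A, m.IsMaximal → IsSemisimpleRing (A ⧸ core m)

/-- Restriction of functionals along `ι` : the map `ι° : H° → A°`. -/
def iotaDual (ι : A →ₗ[k] H) (f : Module.Dual k H) : Module.Dual k A := f ∘ₗ ι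

/-- Coextension of functionals along the projection `Π : H → A`:
the map `Π° : A° → H°`. -/
def PiDual (p : H →ₗ[k] A) (α : Module.Dual k A) : Module.Dual k H := α ∘ₗ p

/-- `A ⊆ H` is an affine commutative-by-finite Hopf algebra, where the
inclusion of the commutative normal Hopf subalgebra `A` is recorded by the
injective Hopf algebra map `ι`. -/
structure CommByFinite (ι : A →ₗ[k] H) : Prop where
  ι_inj : Function.Injective ι
  ι_one : ι 1 = 1
  ι_mul : ∀ a b : A, ι (a * b) = ι a * ι b
  ι_comul : ∀ a : A,
    Coalgebra.comul (R := k) (ι a) = TensorProduct.map ι ι (Coalgebra.comul a)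
  ι_counit : ∀ a : A,
    Coalgebra.counit (R := k) (ι a) = Coalgebra.counit (R := k) a
  ι_antipode : ∀ a : A,
    ι (HopfAlgebra.antipode (R := k) a) = HopfAlgebra.antipode (R := k) (ι a)
  affine : ∃ s : Finset A, Algebra.adjoin k (s : Set A) = ⊤
  normal_left : ∀ (h : H) (a : A), adl k H h (ι a) ∈ Set.range ι
  normal_right : ∀ (h : H) (a : A), adr k H h (ι a) ∈ Set.range ι
  finiteOver : ∃ s : Finset H,
    Submodule.span k {x : H | ∃ (a : A), ∃ y ∈ s, x = ι a * y} = ⊤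

/-- The standing hypothesis: `A` is semiprime (reduced) or central in `H`,
or `H` is pointed. -/
def StandingHyp (ι : A →ₗ[k] H) : Prop :=
  IsReduced A ∨ (∀ (a : A) (h : H), ι a * h = h * ι a) ∨ IsPointedHopf k H

/-- `Π : H → A` is the projection of a direct sum decomposition
`H = A ⊕ X` of right `A`-modules. -/
structure IsSplitting (ι : A →ₗ[k] H) (p : H →ₗ[k] A) : Prop where
  left_inv : ∀ a : A, p (ι a) = a
  right_linear : ∀ (h : H) (a : A), p (h * ι a) = p h * a

/-- Hypothesis (CoSplit) for a given splitting `Π`: the complement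
`X = ker Π` is a coideal of `H`. -/
def CoSplit (p : H →ₗ[k] A) : Prop := IsCoideal k H (LinearMap.ker p)

end Ext

section Quot

variable (A : Type) [CommRing A] [HopfAlgebra k A]
variable (H : Type) [Ring H] [HopfAlgebra k H]
variable (Hb : Type) [Ring Hb] [HopfAlgebra k Hb]

/-- `π : H → H̄` realises `H̄` as the quotient Hopf algebra `H/A⁺H`. -/
structure IsHbarQuotient (ι : A →ₗ[k] H) (π : H →ₗ[k] Hb) : Prop where
  π_surj : Function.Surjective π
  π_one : π 1 = 1
  π_mul : ∀ x y : H, π (x * y) = π x * π y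
  π_comul : ∀ x : H,
    Coalgebra.comul (R := k) (π x) = TensorProduct.map π π (Coalgebra.comul x)
  π_counit : ∀ x : H,
    Coalgebra.counit (R := k) (π x) = Coalgebra.counit (R := k) x
  π_antipode : ∀ x : H,
    π (HopfAlgebra.antipode (R := k) x) = HopfAlgebra.antipode (R := k) (π x)
  π_ker : LinearMap.ker π = augHIdeal k A H ι
  findim : FiniteDimensional k Hb

/-- Composition with `π` : the map `π° : H̄* → H°`. -/
def piDual (π : H →ₗ[k] Hb) (β : Module.Dual k Hb) : Module.Dual k H := β ∘ₗ π

end Quot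

end

end Paper

namespace Paper6

open Paper

section A1
variable {k : Type} [Field k] {H : Type} [Ring H] [HopfAlgebra k H]

/-- tensor of submodules -/
def TT (P Q : Submodule k H) : Submodule k (H ⊗[k] H) :=
  Submodule.map₂ (TensorProduct.mk k H H) P Q

lemma TT_mem {P Q : Submodule k H} {p q : H} (hp : p ∈ P) (hq : q ∈ Q) :
    p ⊗ₜ[k] q ∈ TT P Q := Submodule.apply_mem_map₂ (TensorProduct.mk k H H) hp hq

lemma TT_le {P Q : Submodule k H} {R : Submodule k (H ⊗[k] H)}
    (h : ∀ p ∈ P, ∀ q ∈ Q, p ⊗ₜ[k] q ∈ R) : TT P Q ≤ R :=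
  Submodule.map₂_le.2 h

lemma TT_mono {P Q P' Q' : Submodule k H} (h : P ≤ P') (h' : Q ≤ Q') : TT P Q ≤ TT P' Q' :=
  TT_le fun _ hp _ hq => TT_mem (h hp) (h' hq)

lemma TT_mul (P Q P' Q' : Submodule k H) : TT P Q * TT P' Q' ≤ TT (P * P') (Q * Q') := by
  refine Submodule.mul_le.2 fun m hm n hn => ?_
  have h1 : TT P Q ≤ (TT (P * P') (Q * Q')).comap (LinearMap.mulRight k n) := by
    refine TT_le fun p hp q hq => ?_
    have h2 : TT P' Q' ≤ (TT (P * P') (Q * Q')).comap (LinearMap.mulLeft k (p ⊗ₜ[k] q)) := by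
      refine TT_le fun p' hp' q' hq' => ?_
      simp only [Submodule.mem_comap, LinearMap.mulLeft_apply, Algebra.TensorProduct.tmul_mul_tmul]
      exact TT_mem (Submodule.mul_mem_mul hp hp') (Submodule.mul_mem_mul hq hq')
    exact h2 hn
  exact h1 hm

lemma TT_top : (TT ⊤ ⊤ : Submodule k (H ⊗[k] H)) = ⊤ := by
  rw [eq_top_iff]
  intro x _
  induction x with
  | zero => exact zero_mem _
  | tmul x y => exact TT_mem trivial trivial
  | add x y hx hy => exact add_mem (hx trivial) (hy trivial)

/-- two-sided ideal -/
def TS {B : Type} [Ring B] [Algebra k B] (I : Submodule k B) : Prop :=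
  ∀ (h : B), ∀ x ∈ I, h * x ∈ I ∧ x * h ∈ I

lemma TS.top_mul {B : Type} [Ring B] [Algebra k B] {I : Submodule k B} (h : TS I) : ⊤ * I = I := by
  apply le_antisymm
  · exact Submodule.mul_le.2 fun m _ n hn => (h m n hn).1
  · intro x hx
    simpa using Submodule.mul_mem_mul (Submodule.mem_top (x := (1 : B)) (R := k)) hx

lemma TS.mul_top {B : Type} [Ring B] [Algebra k B] {I : Submodule k B} (h : TS I) : I * ⊤ = I := by
  apply le_antisymm
  · exact Submodule.mul_le.2 fun m hm n _ => (h n m hm).2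
  · intro x hx
    simpa using Submodule.mul_mem_mul hx (Submodule.mem_top (x := (1 : B)) (R := k))

lemma TS.of {B : Type} [Ring B] [Algebra k B] {I : Submodule k B} (h : ⊤ * I ≤ I)
    (h' : I * ⊤ ≤ I) : TS I := fun _ _ hx =>
  ⟨h (Submodule.mul_mem_mul trivial hx), h' (Submodule.mul_mem_mul hx trivial)⟩

lemma TS.sup {B : Type} [Ring B] [Algebra k B] {I J : Submodule k B} (h : TS I) (h' : TS J) :
    TS (I ⊔ J) := by
  refine TS.of ?_ ?_
  · rw [Submodule.mul_sup, h.top_mul, h'.top_mul]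
  · rw [Submodule.sup_mul, h.mul_top, h'.mul_top]

lemma TS.inf {B : Type} [Ring B] [Algebra k B] {I J : Submodule k B} (h : TS I) (h' : TS J) :
    TS (I ⊓ J) := fun b x hx =>
  ⟨⟨(h b x hx.1).1, (h' b x hx.2).1⟩, ⟨(h b x hx.1).2, (h' b x hx.2).2⟩⟩

lemma TS.tt {I J : Submodule k H} (h : TS I) (h' : TS J) : TS (TT I J) := by
  refine TS.of ?_ ?_
  · rw [← TT_top]
    exact (TT_mul _ _ _ _).trans (by rw [h.top_mul, h'.top_mul])
  · rw [← TT_top]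
    exact (TT_mul _ _ _ _).trans (by rw [h.mul_top, h'.mul_top])

lemma TS.top {B : Type} [Ring B] [Algebra k B] : TS (⊤ : Submodule k B) :=
  fun _ _ _ => ⟨trivial, trivial⟩

lemma TS.comul {I : Submodule k (H ⊗[k] H)} (h : TS I) :
    TS (I.comap (Coalgebra.comul (R := k) (A := H))) := by
  intro b x hx
  simp only [Submodule.mem_comap, Bialgebra.comul_mul] at hx ⊢
  exact h _ _ hx

lemma TS.antipode {I : Submodule k H} (h : TS I) :
    TS (I.comap (HopfAlgebra.antipode (R := k) (A := H))) := by
  intro b x hx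
  simp only [Submodule.mem_comap, HopfAlgebra.antipode_mul_antidistrib] at hx ⊢
  exact (h _ _ hx).symm

lemma fd_of_ker {V W : Type} [AddCommGroup V] [Module k V] [AddCommGroup W] [Module k W]
    [FiniteDimensional k W] (g : V →ₗ[k] W) (K : Submodule k V) (h : LinearMap.ker g ≤ K) :
    FiniteDimensional k (V ⧸ K) := by
  have : FiniteDimensional k (V ⧸ LinearMap.ker g) :=
    LinearEquiv.finiteDimensional g.quotKerEquivRange.symm
  exact Module.Finite.of_surjective (Submodule.factor h) (Submodule.factor_surjective h)

lemma fd_comap {V W : Type} [AddCommGroup V] [Module k V] [AddCommGroup W] [Module k W]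
    (g : V →ₗ[k] W) (K : Submodule k W) [FiniteDimensional k (W ⧸ K)] :
    FiniteDimensional k (V ⧸ K.comap g) :=
  fd_of_ker (K.mkQ ∘ₗ g) _ (by rw [LinearMap.ker_comp, Submodule.ker_mkQ])

lemma fd_inf {V : Type} [AddCommGroup V] [Module k V]
    (K L : Submodule k V) [FiniteDimensional k (V ⧸ K)] [FiniteDimensional k (V ⧸ L)] :
    FiniteDimensional k (V ⧸ (K ⊓ L)) :=
  fd_of_ker (K.mkQ.prod L.mkQ) _ (by rw [LinearMap.ker_prod]; simp)

lemma fd_mono {V : Type} [AddCommGroup V] [Module k V]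
    (K L : Submodule k V) [FiniteDimensional k (V ⧸ K)] (h : K ≤ L) :
    FiniteDimensional k (V ⧸ L) :=
  fd_of_ker K.mkQ _ (by simpa using h)

lemma fd_TT (K L : Submodule k H) [FiniteDimensional k (H ⧸ K)] [FiniteDimensional k (H ⧸ L)] :
    FiniteDimensional k ((H ⊗[k] H) ⧸ (TT K ⊤ ⊔ TT ⊤ L)) := by
  refine fd_of_ker (TensorProduct.map K.mkQ L.mkQ) _ ?_
  have e1 : Function.Exact K.subtype K.mkQ := by
    rw [LinearMap.exact_iff]; simp
  have e2 : Function.Exact L.subtype L.mkQ := by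
    rw [LinearMap.exact_iff]; simp
  rw [TensorProduct.map_ker e1 K.mkQ_surjective e2 L.mkQ_surjective]
  refine sup_le ?_ ?_
  · rintro _ ⟨x, rfl⟩
    induction x with
    | zero => simp
    | tmul x y => exact Submodule.mem_sup_right (TT_mem trivial y.2)
    | add x y hx hy => rw [map_add]; exact add_mem hx hy
  · rintro _ ⟨x, rfl⟩
    induction x with
    | zero => simp
    | tmul x y => exact Submodule.mem_sup_left (TT_mem x.2 trivial)
    | add x y hx hy => rw [map_add]; exact add_mem hx hy

lemma TT_kill (f g : Module.Dual k H) (K L : Submodule k H) (hf : ∀ x ∈ K, f x = 0)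
    (hg : ∀ x ∈ L, g x = 0) :
    TT K ⊤ ⊔ TT ⊤ L ≤ LinearMap.ker ((TensorProduct.lid k k).toLinearMap ∘ₗ
      TensorProduct.map f g) := by
  refine sup_le ?_ ?_
  · exact TT_le fun p hp q hq => by simp [hf p hp]
  · exact TT_le fun p hp q hq => by simp [hg q hq]

lemma conv_kill (f g : Module.Dual k H) (K L M : Submodule k H) (hf : ∀ x ∈ K, f x = 0)
    (hg : ∀ x ∈ L, g x = 0)
    (hM : M ≤ (TT K ⊤ ⊔ TT ⊤ L).comap (Coalgebra.comul (R := k) (A := H))) :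
    ∀ x ∈ M, conv k f g x = 0 := fun _ hx => TT_kill f g K L hf hg (hM hx)

lemma fin_add {f g : Module.Dual k H} (hf : f ∈ finDual k H) (hg : g ∈ finDual k H) :
    f + g ∈ finDual k H := by
  obtain ⟨I, h1, h2, h3⟩ := hf
  obtain ⟨J, h1', h2', h3'⟩ := hg
  refine ⟨I ⊓ J, TS.inf h1 h1', fun x hx => ?_, fd_inf I J⟩
  have a := h2 hx.1
  have b := h2' hx.2
  simp only [LinearMap.mem_ker, LinearMap.add_apply] at *
  rw [a, b, add_zero]

lemma fin_smul (c : k) {f : Module.Dual k H} (hf : f ∈ finDual k H) :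
    c • f ∈ finDual k H := by
  obtain ⟨I, h1, h2, h3⟩ := hf
  refine ⟨I, h1, fun x hx => ?_, h3⟩
  have a := h2 hx
  simp only [LinearMap.mem_ker, LinearMap.smul_apply] at *
  rw [a, smul_zero]

lemma fin_zero : (0 : Module.Dual k H) ∈ finDual k H :=
  ⟨⊤, TS.top, by simp, inferInstance⟩

lemma fin_sum {n : ℕ} (f : Fin n → Module.Dual k H) (h : ∀ i, f i ∈ finDual k H) :
    ∑ i, f i ∈ finDual k H :=
  Finset.sum_induction f (· ∈ finDual k H) (fun _ _ => fin_add) fin_zero fun i _ => h i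

lemma fin_one : (convOne k : Module.Dual k H) ∈ finDual k H := by
  refine ⟨LinearMap.ker (Coalgebra.counit (R := k) (A := H)), ?_, le_rfl,
    fd_of_ker (Coalgebra.counit (R := k) (A := H)) _ le_rfl⟩
  intro h x hx
  simp only [LinearMap.mem_ker, Bialgebra.counit_mul] at *
  simp [hx]

lemma fin_conv {f g : Module.Dual k H} (hf : f ∈ finDual k H) (hg : g ∈ finDual k H) :
    conv k f g ∈ finDual k H := by
  obtain ⟨I, h1, h2, h3⟩ := hf
  obtain ⟨J, h1', h2', h3'⟩ := hg
  have := fd_TT I J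
  refine ⟨(TT I ⊤ ⊔ TT ⊤ J).comap (Coalgebra.comul (R := k) (A := H)), ?_, ?_, fd_comap _ _⟩
  · exact TS.comul ((TS.tt h1 TS.top).sup (TS.tt TS.top h1'))
  · exact conv_kill f g I J _ h2 h2' le_rfl

lemma fin_antipode {f : Module.Dual k H} (hf : f ∈ finDual k H) :
    f ∘ₗ HopfAlgebra.antipode (R := k) ∈ finDual k H := by
  obtain ⟨I, h1, h2, h3⟩ := hf
  exact ⟨I.comap (HopfAlgebra.antipode (R := k)), TS.antipode h1, fun x hx => h2 hx, fd_comap _ _⟩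

lemma fin_coprod {f : Module.Dual k H} (hf : f ∈ finDual k H) (P : Submodule k H) (hP : TS P)
    (hfP : ∀ x ∈ P, f x = 0) :
    ∃ (n : ℕ) (s t : Fin n → Module.Dual k H),
      (∀ i, (s i ∈ finDual k H ∧ ∀ x ∈ P, s i x = 0) ∧
        (t i ∈ finDual k H ∧ ∀ x ∈ P, t i x = 0)) ∧
      ∀ x y : H, f (x * y) = ∑ i, s i x * t i y := by
  obtain ⟨I, h1, h2, h3⟩ := hf
  have hK : TS (I ⊔ P) := TS.sup h1 hP
  have hfK : I ⊔ P ≤ LinearMap.ker f := sup_le h2 hfP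
  have : FiniteDimensional k (H ⧸ (I ⊔ P)) := fd_mono I _ le_sup_left
  have hI : I ≤ I ⊔ P := le_sup_left
  have hPK : P ≤ I ⊔ P := le_sup_right
  generalize I ⊔ P = K at *
  let b := Module.finBasis k (H ⧸ K)
  choose y hy using fun i => K.mkQ_surjective (b i)
  have hs : ∀ i, ∀ x ∈ K, (f ∘ₗ LinearMap.mulRight k (y i)) x = 0 := fun i x hx =>
    hfK (hK (y i) x hx).2
  have ht : ∀ i, ∀ x ∈ K, (b.coord i ∘ₗ K.mkQ) x = 0 := fun i x hx => by
    rw [LinearMap.comp_apply, Submodule.mkQ_apply, (Submodule.Quotient.mk_eq_zero K).2 hx, map_zero]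
  refine ⟨_, fun i => f ∘ₗ LinearMap.mulRight k (y i), fun i => b.coord i ∘ₗ K.mkQ,
    fun i => ⟨⟨⟨K, hK, hs i, this⟩, fun x hx => hs i x (hPK hx)⟩,
      ⟨⟨K, hK, ht i, this⟩, fun x hx => ht i x (hPK hx)⟩⟩, fun x z => ?_⟩
  have hz : z - ∑ i, b.coord i (K.mkQ z) • y i ∈ K := by
    refine (Submodule.Quotient.mk_eq_zero K).1 ?_
    rw [← Submodule.mkQ_apply, map_sub, map_sum]
    simp only [map_smul, hy]
    rw [sub_eq_zero]
    exact (b.sum_repr _).symm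
  have h4 := hfK (hK x _ hz).1
  rw [LinearMap.mem_ker, mul_sub, map_sub, sub_eq_zero, Finset.mul_sum, map_sum] at h4
  rw [h4]
  refine Finset.sum_congr rfl fun i _ => ?_
  simp [mul_comm]

lemma S_pow (I : Submodule k H) (hS : I ≤ I.comap (HopfAlgebra.antipode (R := k) (A := H))) (n : ℕ) :
    I ^ n ≤ (I ^ n).comap (HopfAlgebra.antipode (R := k) (A := H)) := by
  induction n with
  | zero =>
    intro x hx
    rw [pow_zero] at *
    obtain ⟨c, rfl⟩ := Submodule.mem_one.1 hx
    rw [Submodule.mem_comap, Algebra.algebraMap_eq_smul_one, map_smul, HopfAlgebra.antipode_one]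
    exact Submodule.smul_mem _ _ (Submodule.one_le.1 le_rfl)
  | succ n ih =>
    rw [pow_succ]
    refine Submodule.mul_le.2 fun m hm x hx => ?_
    rw [Submodule.mem_comap, HopfAlgebra.antipode_mul_antidistrib, ← pow_succ, pow_succ']
    exact Submodule.mul_mem_mul (hS hx) (ih hm)

/-- powers with zeroth power the whole ring -/
def JJ (I : Submodule k H) (n : ℕ) : Submodule k H := ⊤ * I ^ n

lemma JJ_succ (I : Submodule k H) (n : ℕ) : JJ I (n + 1) = JJ I n * I := by
  rw [JJ, JJ, pow_succ, mul_assoc]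

lemma JJ_zero (I : Submodule k H) : JJ I 0 = ⊤ := by
  rw [JJ, pow_zero, mul_one]

lemma JJ_TS {I : Submodule k H} (h : TS I) (n : ℕ) : TS (JJ I n) := by
  induction n with
  | zero => rw [JJ_zero]; exact TS.top
  | succ n ih =>
    rw [JJ_succ]
    exact TS.of (by rw [← mul_assoc, ih.top_mul]) (by rw [mul_assoc, h.mul_top])

lemma JJ_pos {I : Submodule k H} (h : TS I) {n : ℕ} (hn : 0 < n) : JJ I n = I ^ n := by
  obtain ⟨m, rfl⟩ : ∃ m, n = m + 1 := ⟨n - 1, by omega⟩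
  rw [JJ, pow_succ', ← mul_assoc, h.top_mul]

lemma JJ_succ' {I : Submodule k H} (h : TS I) (n : ℕ) : JJ I (n + 1) = I * JJ I n := by
  rw [JJ_pos h (Nat.succ_pos n), JJ, ← mul_assoc, h.mul_top, pow_succ']

lemma JJ_anti {I : Submodule k H} (h : TS I) {m n : ℕ} (hmn : m ≤ n) : JJ I n ≤ JJ I m := by
  induction n, hmn using Nat.le_induction with
  | base => exact le_rfl
  | succ n _ ih =>
    refine le_trans ?_ ih
    rw [JJ_succ]
    exact Submodule.mul_le.2 fun a ha b _ => (JJ_TS h n b a ha).2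

lemma comul_JJ {I : Submodule k H} (h : TS I)
    (hΔ : I ≤ (TT I ⊤ ⊔ TT ⊤ I).comap (Coalgebra.comul (R := k) (A := H))) (N : ℕ) :
    JJ I N ≤ (⨆ p : {p : ℕ × ℕ // p.1 + p.2 = N},
      TT (JJ I p.1.1) (JJ I p.1.2)).comap (Coalgebra.comul (R := k) (A := H)) := by
  induction N with
  | zero =>
    have : (⊤ : Submodule k (H ⊗[k] H)) ≤ ⨆ p : {p : ℕ × ℕ // p.1 + p.2 = 0},
      TT (JJ I p.1.1) (JJ I p.1.2) := by
      refine le_trans ?_ (le_iSup _ ⟨(0, 0), rfl⟩)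
      simp only [JJ_zero, TT_top, le_refl]
    exact fun x _ => this trivial
  | succ N ih =>
    rw [JJ_succ]
    refine Submodule.mul_le.2 fun m hm x hx => ?_
    rw [Submodule.mem_comap, Bialgebra.comul_mul]
    have := Submodule.mul_mem_mul (Submodule.mem_comap.1 (ih hm)) (Submodule.mem_comap.1 (hΔ hx))
    refine (?_ : (_ : Submodule k (H ⊗[k] H)) ≤ _) this
    rw [Submodule.iSup_mul]
    refine iSup_le fun ⟨⟨i, j⟩, hij⟩ => ?_
    rw [Submodule.mul_sup]
    simp only at hij ⊢
    refine sup_le ?_ ?_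
    · refine le_trans ?_ (le_iSup _ ⟨(i + 1, j), by simp only; omega⟩)
      refine (TT_mul _ _ _ _).trans ?_
      simp only [JJ_succ, (JJ_TS h j).mul_top, le_refl]
    · refine le_trans ?_ (le_iSup _ ⟨(i, j + 1), by simp only; omega⟩)
      refine (TT_mul _ _ _ _).trans ?_
      simp only [JJ_succ, (JJ_TS h i).mul_top, le_refl]

lemma comul_JJ' {I : Submodule k H} (h : TS I)
    (hΔ : I ≤ (TT I ⊤ ⊔ TT ⊤ I).comap (Coalgebra.comul (R := k) (A := H))) (n m : ℕ) :
    JJ I (n + m) ≤ (TT (JJ I n) ⊤ ⊔ TT ⊤ (JJ I m)).comap (Coalgebra.comul (R := k) (A := H)) := by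
  refine (comul_JJ h hΔ _).trans (Submodule.comap_mono (iSup_le fun ⟨⟨i, j⟩, hij⟩ => ?_))
  simp only at hij ⊢
  by_cases hi : n ≤ i
  · exact le_sup_of_le_left (TT_mono (JJ_anti h hi) le_top)
  · exact le_sup_of_le_right (TT_mono le_top (JJ_anti h (by omega)))

end A1

end Paper6

namespace Paper6

open Paper

section A2
variable {k : Type} [Field k] {H : Type} [Ring H] [HopfAlgebra k H]

local notation "SS" => HopfAlgebra.antipode k

/-- iterated comultiplication -/
def D3 (k : Type) [Field k] {H : Type} [Ring H] [HopfAlgebra k H] : H →ₗ[k] H ⊗[k] (H ⊗[k] H) :=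
  (Coalgebra.comul (R := k) (A := H)).lTensor H ∘ₗ Coalgebra.comul

lemma D3_mul (x y : H) : D3 k (x * y) = D3 k x * D3 k y := by
  have : ∀ z : H, D3 k z = ((Algebra.TensorProduct.map (AlgHom.id k H)
    (Bialgebra.comulAlgHom k H)).comp (Bialgebra.comulAlgHom k H)) z := fun z => rfl
  rw [this, this, this, map_mul]

/-- x ⊗ y ⊗ z ↦ φ(x b S z) y -/
def LL (φ : Module.Dual k H) (b : H) : H ⊗[k] (H ⊗[k] H) →ₗ[k] H :=
  (TensorProduct.lid k H).toLinearMap ∘ₗ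
    (φ ∘ₗ LinearMap.mul' k H ∘ₗ TensorProduct.map (LinearMap.mulRight k b) SS).rTensor H ∘ₗ
    (TensorProduct.assoc k H H H).symm.toLinearMap ∘ₗ
    ((TensorProduct.comm k H H).toLinearMap.lTensor H)

/-- x ⊗ y ⊗ z ↦ φ(S x b z) y -/
def RR (φ : Module.Dual k H) (b : H) : H ⊗[k] (H ⊗[k] H) →ₗ[k] H :=
  (TensorProduct.lid k H).toLinearMap ∘ₗ
    (φ ∘ₗ LinearMap.mul' k H ∘ₗ TensorProduct.map SS (LinearMap.mulLeft k b)).rTensor H ∘ₗ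
    (TensorProduct.assoc k H H H).symm.toLinearMap ∘ₗ
    ((TensorProduct.comm k H H).toLinearMap.lTensor H)

lemma LL_tmul (φ : Module.Dual k H) (b x y z : H) :
    LL φ b (x ⊗ₜ (y ⊗ₜ z)) = φ (x * b * SS z) • y := by simp [LL]

lemma RR_tmul (φ : Module.Dual k H) (b x y z : H) :
    RR φ b (x ⊗ₜ (y ⊗ₜ z)) = φ (SS x * (b * z)) • y := by simp [RR]

lemma ind3 {U : Type} [AddCommGroup U] [Module k U] {p : U ⊗[k] (U ⊗[k] U) → Prop} (h0 : p 0)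
    (h1 : ∀ x y z, p (x ⊗ₜ (y ⊗ₜ z))) (h2 : ∀ u v, p u → p v → p (u + v)) (u) : p u := by
  induction u with
  | zero => exact h0
  | add x y hx hy => exact h2 _ _ hx hy
  | tmul x y =>
    induction y with
    | zero => rwa [TensorProduct.tmul_zero]
    | add y z hy hz => rw [TensorProduct.tmul_add]; exact h2 _ _ hy hz
    | tmul y z => exact h1 _ _ _

lemma LL_add (φ : Module.Dual k H) (b c : H) (T) : LL φ (b + c) T = LL φ b T + LL φ c T := by
  induction T using ind3 with
  | h0 => simp
  | h1 x y z => simp only [LL_tmul, mul_add, add_mul, map_add, add_smul]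
  | h2 u v hu hv => rw [map_add, hu, hv, map_add, map_add]; abel

lemma RR_add (φ : Module.Dual k H) (b c : H) (T) : RR φ (b + c) T = RR φ b T + RR φ c T := by
  induction T using ind3 with
  | h0 => simp
  | h1 x y z => simp only [RR_tmul, mul_add, add_mul, map_add, add_smul]
  | h2 u v hu hv => rw [map_add, hu, hv, map_add, map_add]; abel

lemma LL_smul (φ : Module.Dual k H) (r : k) (b : H) (T) : LL φ (r • b) T = r • LL φ b T := by
  induction T using ind3 with
  | h0 => simp
  | h1 x y z => simp [LL_tmul, mul_smul]
  | h2 u v hu hv => rw [map_add, hu, hv, map_add, smul_add]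

lemma RR_smul (φ : Module.Dual k H) (r : k) (b : H) (T) : RR φ (r • b) T = r • RR φ b T := by
  induction T using ind3 with
  | h0 => simp
  | h1 x y z => simp [RR_tmul, mul_smul]
  | h2 u v hu hv => rw [map_add, hu, hv, map_add, smul_add]

lemma LL_mul (φ : Module.Dual k H) (b x y z : H) (T) :
    LL φ b (T * (x ⊗ₜ (y ⊗ₜ z))) = LL φ (x * b * SS z) T * y := by
  induction T using ind3 with
  | h0 => simp
  | h1 x y z => simp [LL_tmul, HopfAlgebra.antipode_mul_antidistrib, mul_assoc]
  | h2 u v hu hv => rw [add_mul, map_add, hu, hv, map_add, add_mul]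

lemma RR_mul (φ : Module.Dual k H) (b x y z : H) (T) :
    RR φ b ((x ⊗ₜ (y ⊗ₜ z)) * T) = y * RR φ (SS x * b * z) T := by
  induction T using ind3 with
  | h0 => simp
  | h1 x y z => simp [RR_tmul, HopfAlgebra.antipode_mul_antidistrib, mul_assoc]
  | h2 u v hu hv => rw [mul_add, map_add, hu, hv, map_add, mul_add]

lemma adld_eq (φ f : Module.Dual k H) (x : H) : adld k H φ f x = f (LL φ 1 (D3 k x)) := by
  have : ∀ T, ((TensorProduct.lid k k).toLinearMap ∘ₗ
    TensorProduct.map (φ ∘ₗ LinearMap.mul' k H ∘ₗ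
      (HopfAlgebra.antipode (R := k)).lTensor H) f ∘ₗ
    (TensorProduct.assoc k H H H).symm.toLinearMap ∘ₗ
    ((TensorProduct.comm k H H).toLinearMap.lTensor H)) T = f (LL φ 1 T) := by
    intro T
    induction T using ind3 with
    | h0 => simp
    | h1 x y z => simp [LL_tmul]
    | h2 u v hu hv => rw [map_add, hu, hv, map_add, map_add]
  exact this (D3 k x)

lemma adrd_eq (φ f : Module.Dual k H) (x : H) : adrd k H φ f x = f (RR φ 1 (D3 k x)) := by
  have : ∀ T, ((TensorProduct.lid k k).toLinearMap ∘ₗ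
    TensorProduct.map (φ ∘ₗ LinearMap.mul' k H ∘ₗ
      (HopfAlgebra.antipode (R := k)).rTensor H) f ∘ₗ
    (TensorProduct.assoc k H H H).symm.toLinearMap ∘ₗ
    ((TensorProduct.comm k H H).toLinearMap.lTensor H)) T = f (RR φ 1 T) := by
    intro T
    induction T using ind3 with
    | h0 => simp
    | h1 x y z => simp [RR_tmul]
    | h2 u v hu hv => rw [map_add, hu, hv, map_add, map_add]
  exact this (D3 k x)

/-- triple functional -/
def F3 (f g h : Module.Dual k H) : H ⊗[k] (H ⊗[k] H) →ₗ[k] k :=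
  (TensorProduct.lid k k).toLinearMap ∘ₗ TensorProduct.map f
    ((TensorProduct.lid k k).toLinearMap ∘ₗ TensorProduct.map g h)

lemma conv3 (f g h : Module.Dual k H) (x : H) : conv k f (conv k g h) x = F3 f g h (D3 k x) := by
  have : ∀ U : H ⊗[k] H, ((TensorProduct.lid k k).toLinearMap ∘ₗ TensorProduct.map f
      (conv k g h)) U = F3 f g h ((Coalgebra.comul (R := k) (A := H)).lTensor H U) := by
    intro U
    induction U with
    | zero => simp
    | add x y hx hy => rw [map_add, hx, hy, map_add, map_add]
    | tmul x y => simp [F3, conv]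
  exact this _

lemma fin_adld {φ f : Module.Dual k H} (hφ : φ ∈ finDual k H) (hf : f ∈ finDual k H) :
    adld k H φ f ∈ finDual k H := by
  obtain ⟨n, s, t, hst, he⟩ := fin_coprod hφ ⊥ (fun b x hx => by simp_all) (by simp)
  have : adld k H φ f = ∑ i, conv k (s i) (conv k f (t i ∘ₗ HopfAlgebra.antipode (R := k))) := by
    ext x
    rw [adld_eq, LinearMap.sum_apply]
    simp only [conv3]
    generalize D3 k x = T
    induction T using ind3 with
    | h0 => simp
    | h1 x y z =>
      simp [LL_tmul, he, F3, Finset.sum_mul]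
      exact Finset.sum_congr rfl fun i _ => by ring
    | h2 u v hu hv => simp only [map_add, hu, hv, Finset.sum_add_distrib]
  rw [this]
  exact fin_sum _ fun i => fin_conv (hst i).1.1 (fin_conv hf (fin_antipode (hst i).2.1))

lemma fin_adrd {φ f : Module.Dual k H} (hφ : φ ∈ finDual k H) (hf : f ∈ finDual k H) :
    adrd k H φ f ∈ finDual k H := by
  obtain ⟨n, s, t, hst, he⟩ := fin_coprod hφ ⊥ (fun b x hx => by simp_all) (by simp)
  have : adrd k H φ f = ∑ i, conv k (s i ∘ₗ HopfAlgebra.antipode (R := k)) (conv k f (t i)) := by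
    ext x
    rw [adrd_eq, LinearMap.sum_apply]
    simp only [conv3]
    generalize D3 k x = T
    induction T using ind3 with
    | h0 => simp
    | h1 x y z =>
      simp [RR_tmul, he, F3, Finset.sum_mul]
      exact Finset.sum_congr rfl fun i _ => by ring
    | h2 u v hu hv => simp only [map_add, hu, hv, Finset.sum_add_distrib]
  rw [this]
  exact fin_sum _ fun i => fin_conv (fin_antipode (hst i).1.1) (fin_conv hf (hst i).2.1)

end A2

section A3

variable {k : Type} [Field k] {H : Type} [Ring H] [HopfAlgebra k H]

lemma counit_via (U : H ⊗[k] H) (h : H) (hU : U = Coalgebra.comul (R := k) h)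
    (g : H ⊗[k] H →ₗ[k] k) (c : k)
    (hg : ∀ x y, g (x ⊗ₜ y) = Coalgebra.counit (R := k) x * c * Coalgebra.counit (R := k) y) :
    g U = c * Coalgebra.counit (R := k) h := by
  have : ∀ U, g U = c * Coalgebra.counit (R := k)
      (TensorProduct.lid k H ((Coalgebra.counit (R := k) (A := H)).rTensor H U)) := by
    intro U
    induction U with
    | zero => simp
    | add x y hx hy => rw [map_add, hx, hy, map_add, map_add, map_add, mul_add]
    | tmul x y => rw [hg]; simp; ring
  rw [this, hU, Coalgebra.rTensor_counit_comul]; simp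

lemma counit_adl (h a : H) : Coalgebra.counit (R := k) (adl k H h a) =
    Coalgebra.counit (R := k) a * Coalgebra.counit (R := k) h := by
  refine counit_via _ h rfl (Coalgebra.counit (R := k) ∘ₗ TensorProduct.lift
    (((LinearMap.mul k H).comp (LinearMap.mulRight k a)).compl₂
    (HopfAlgebra.antipode (R := k)))) _ ?_
  intro x y; simp

lemma counit_adr (h a : H) : Coalgebra.counit (R := k) (adr k H h a) =
    Coalgebra.counit (R := k) a * Coalgebra.counit (R := k) h := by
  refine counit_via _ h rfl (Coalgebra.counit (R := k) ∘ₗ TensorProduct.lift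
    ((LinearMap.mul k H).comp ((LinearMap.mulRight k a) ∘ₗ
    (HopfAlgebra.antipode (R := k))))) _ ?_
  intro x y; simp

/-- linear version of adl -/
def adlL (a : H) : H →ₗ[k] H := TensorProduct.lift
    (((LinearMap.mul k H).comp (LinearMap.mulRight k a)).compl₂
    (HopfAlgebra.antipode (R := k))) ∘ₗ Coalgebra.comul

/-- linear version of adr -/
def adrL (a : H) : H →ₗ[k] H := TensorProduct.lift
    ((LinearMap.mul k H).comp ((LinearMap.mulRight k a) ∘ₗ
    (HopfAlgebra.antipode (R := k)))) ∘ₗ Coalgebra.comul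

lemma adl_sum (h a : H) :
    LinearMap.mul' k H ((adlL (k := k) a).rTensor H (Coalgebra.comul (R := k) h)) = h * a := by
  rw [adlL, LinearMap.rTensor_comp, LinearMap.comp_apply, ← Coalgebra.coassoc_symm_apply]
  have : ∀ U : H ⊗[k] H, LinearMap.mul' k H ((TensorProduct.lift
    (((LinearMap.mul k H).comp (LinearMap.mulRight k a)).compl₂
    (HopfAlgebra.antipode (R := k)))).rTensor H ((TensorProduct.assoc k H H H).symm
      ((Coalgebra.comul (R := k) (A := H)).lTensor H U))) =
      LinearMap.mul' k H (TensorProduct.map (LinearMap.mulRight k a)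
        (Algebra.linearMap k H) ((Coalgebra.counit (R := k) (A := H)).lTensor H U)) := by
    intro U
    induction U with
    | zero => simp
    | add x y hx hy => simp only [map_add, hx, hy]
    | tmul x y =>
      have h1 := HopfAlgebra.mul_antipode_rTensor_comul_apply (R := k) y
      simp only [LinearMap.lTensor_tmul, TensorProduct.map_tmul, LinearMap.mul'_apply,
        Algebra.linearMap_apply, ← h1]
      generalize (Coalgebra.comul (R := k) y) = V
      induction V with
      | zero => simp
      | add u v hu hv => simp only [map_add, hu, hv, TensorProduct.tmul_add, mul_add]
      | tmul u v => simp [mul_assoc]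
  rw [this, Coalgebra.lTensor_counit_comul]
  simp

lemma adr_sum (h a : H) :
    LinearMap.mul' k H ((adrL (k := k) a).lTensor H (Coalgebra.comul (R := k) h)) = a * h := by
  rw [adrL, LinearMap.lTensor_comp, LinearMap.comp_apply, ← Coalgebra.coassoc_apply]
  have : ∀ U : H ⊗[k] H, LinearMap.mul' k H ((TensorProduct.lift
    ((LinearMap.mul k H).comp ((LinearMap.mulRight k a) ∘ₗ
    (HopfAlgebra.antipode (R := k))))).lTensor H ((TensorProduct.assoc k H H H)
      ((Coalgebra.comul (R := k) (A := H)).rTensor H U))) =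
      LinearMap.mul' k H (TensorProduct.map (Algebra.linearMap k H) (LinearMap.mulLeft k a)
        ((Coalgebra.counit (R := k) (A := H)).rTensor H U)) := by
    intro U
    induction U with
    | zero => simp
    | add x y hx hy => simp only [map_add, hx, hy]
    | tmul x y =>
      have h1 := HopfAlgebra.mul_antipode_lTensor_comul_apply (R := k) x
      simp only [LinearMap.rTensor_tmul, TensorProduct.map_tmul, LinearMap.mul'_apply,
        Algebra.linearMap_apply, ← h1]
      generalize (Coalgebra.comul (R := k) x) = V
      induction V with
      | zero => simp
      | add u v hu hv => simp only [map_add, hu, hv, TensorProduct.add_tmul, add_mul]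
      | tmul u v => simp [mul_assoc]
  rw [this, Coalgebra.rTensor_counit_comul]
  simp

end A3

end Paper6

namespace Paper6

open Paper

section A4

variable {k : Type} [Field k] {A : Type} [CommRing A] [HopfAlgebra k A]
  {H : Type} [Ring H] [HopfAlgebra k H] {ι : A →ₗ[k] H}

local notation "II" => augHIdeal k A H ι

lemma aug_gen {a : A} (ha : Coalgebra.counit (R := k) a = 0) (h : H) : ι a * h ∈ II :=
  Submodule.subset_span ⟨a, h, ha, rfl⟩

lemma aug_mul_right {x : H} (hx : x ∈ II) (h : H) : x * h ∈ II := by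
  have : II ≤ (II).comap (LinearMap.mulRight k h) := by
    refine Submodule.span_le.2 ?_
    rintro _ ⟨a, g, ha, rfl⟩
    simp only [Submodule.comap_coe, Set.mem_preimage, LinearMap.mulRight_apply, mul_assoc]
    exact aug_gen ha _
  exact this hx

lemma aug_left (hC : CommByFinite k A H ι) {a : A} (ha : Coalgebra.counit (R := k) a = 0) (h : H) :
    h * ι a ∈ II := by
  rw [← adl_sum (k := k) h (ι a)]
  generalize Coalgebra.comul (R := k) h = U
  induction U with
  | zero => simp
  | add x y hx hy => rw [map_add, map_add]; exact add_mem hx hy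
  | tmul x y =>
    simp only [LinearMap.rTensor_tmul, LinearMap.mul'_apply]
    obtain ⟨b, hb⟩ := hC.normal_left x a
    change adl k H x (ι a) * y ∈ _
    rw [← hb]
    refine aug_gen ?_ _
    rw [← hC.ι_counit, hb, counit_adl, hC.ι_counit, ha, zero_mul]

lemma aug_TS (hC : CommByFinite k A H ι) : TS (II) := by
  intro h x hx
  refine ⟨?_, aug_mul_right hx h⟩
  have : II ≤ (II).comap (LinearMap.mulLeft k h) := by
    refine Submodule.span_le.2 ?_
    rintro _ ⟨a, g, ha, rfl⟩
    simp only [Submodule.comap_coe, Set.mem_preimage, LinearMap.mulLeft_apply, ← mul_assoc]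
    exact aug_mul_right (aug_left hC ha h) g
  exact this hx

lemma aug_le (hC : CommByFinite k A H ι) {P : Submodule k H}
    (h : ∀ (h : H) (a : A), Coalgebra.counit (R := k) a = 0 → h * ι a ∈ P) : II ≤ P := by
  refine Submodule.span_le.2 ?_
  rintro _ ⟨a, g, ha, rfl⟩
  rw [SetLike.mem_coe, ← adr_sum (k := k) g (ι a)]
  generalize Coalgebra.comul (R := k) g = U
  induction U with
  | zero => simp
  | add x y hx hy => rw [map_add, map_add]; exact add_mem hx hy
  | tmul x y =>
    simp only [LinearMap.lTensor_tmul, LinearMap.mul'_apply]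
    obtain ⟨b, hb⟩ := hC.normal_right y a
    change x * adr k H y (ι a) ∈ _
    rw [← hb]
    refine h _ _ ?_
    rw [← hC.ι_counit, hb, counit_adr, hC.ι_counit, ha, zero_mul]

lemma aug_counit (hC : CommByFinite k A H ι) : ∀ x ∈ II, Coalgebra.counit (R := k) x = 0 := by
  have : II ≤ LinearMap.ker (Coalgebra.counit (R := k) (A := H)) := by
    refine Submodule.span_le.2 ?_
    rintro _ ⟨a, g, ha, rfl⟩
    simp [hC.ι_counit, ha]
  exact this

lemma aug_S (hC : CommByFinite k A H ι) :
    II ≤ (II).comap (HopfAlgebra.antipode (R := k) (A := H)) := by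
  refine Submodule.span_le.2 ?_
  rintro _ ⟨a, g, ha, rfl⟩
  simp only [Submodule.comap_coe, Set.mem_preimage, HopfAlgebra.antipode_mul_antidistrib,
    ← hC.ι_antipode]
  exact aug_left hC (by simpa using ha) _

lemma sub_mem_aug (hC : CommByFinite k A H ι) (a : A) :
    ι a - Coalgebra.counit (R := k) a • (1 : H) ∈ II := by
  have : ι (a - Coalgebra.counit (R := k) a • 1) * 1 ∈ II := aug_gen (by simp) _
  simpa [hC.ι_one] using this

lemma aug_comul (hC : CommByFinite k A H ι) :
    II ≤ (TT (II) ⊤ ⊔ TT ⊤ (II)).comap (Coalgebra.comul (R := k) (A := H)) := by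
  have hI := aug_TS hC
  refine Submodule.span_le.2 ?_
  rintro _ ⟨a, g, ha, rfl⟩
  simp only [Submodule.comap_coe, Set.mem_preimage, Bialgebra.comul_mul]
  refine (((TS.tt hI TS.top).sup (TS.tt TS.top hI)) _ _ ?_).2
  rw [hC.ι_comul]
  have : ∀ U : A ⊗[k] A, TensorProduct.map ι ι U - (1 : H) ⊗ₜ[k] ι (TensorProduct.lid k A
      ((Coalgebra.counit (R := k) (A := A)).rTensor A U)) ∈ TT (II) ⊤ := by
    intro U
    induction U with
    | zero => simp
    | add x y hx hy =>
      simp only [map_add, TensorProduct.tmul_add]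
      rw [add_sub_add_comm]
      exact add_mem hx hy
    | tmul x y =>
      have := TT_mem (sub_mem_aug hC x) (Submodule.mem_top (x := ι y) (R := k))
      simpa [TensorProduct.sub_tmul, TensorProduct.smul_tmul] using this
  have h1 := this (Coalgebra.comul a)
  rw [Coalgebra.rTensor_counit_comul] at h1
  have h2 : (1 : H) ⊗ₜ[k] ι (TensorProduct.lid k A ((1 : k) ⊗ₜ[k] a)) ∈ TT ⊤ (II) := by
    refine TT_mem trivial ?_
    simpa using aug_gen (ι := ι) ha 1
  simpa using add_mem (Submodule.mem_sup_left h1) (Submodule.mem_sup_right h2)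

lemma D3_ι (hC : CommByFinite k A H ι) (a : A) :
    D3 k (ι a) = TensorProduct.map ι (TensorProduct.map ι ι) (D3 k a) := by
  rw [D3, LinearMap.comp_apply, hC.ι_comul, D3, LinearMap.comp_apply]
  generalize Coalgebra.comul (R := k) a = U
  induction U with
  | zero => simp
  | add x y hx hy => simp only [map_add, hx, hy]
  | tmul x y => simp [hC.ι_comul]

/-- x ⊗ y ⊗ z ↦ ε(y) x ⊗ z -/
def EE : A ⊗[k] (A ⊗[k] A) →ₗ[k] A ⊗[k] A :=
  ((TensorProduct.lid k A).toLinearMap ∘ₗ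
    (Coalgebra.counit (R := k) (A := A)).rTensor A).lTensor A

lemma EE_D3 (a : A) : EE (k := k) (D3 k a) = Coalgebra.comul (R := k) a := by
  rw [D3, LinearMap.comp_apply, EE, ← LinearMap.lTensor_comp_apply]
  have : ((TensorProduct.lid k A).toLinearMap ∘ₗ
    (Coalgebra.counit (R := k) (A := A)).rTensor A) ∘ₗ Coalgebra.comul = LinearMap.id := by
    ext x; simp
  rw [this]; simp

/-- x ⊗ y ⊗ z ↦ ε(y) b x S(z) -/
def N1 (b : A) : A ⊗[k] (A ⊗[k] A) →ₗ[k] A :=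
  LinearMap.mulLeft k b ∘ₗ LinearMap.mul' k A ∘ₗ
    (HopfAlgebra.antipode (R := k) (A := A)).lTensor A ∘ₗ EE

/-- x ⊗ y ⊗ z ↦ ε(y) b S(x) z -/
def N2 (b : A) : A ⊗[k] (A ⊗[k] A) →ₗ[k] A :=
  LinearMap.mulLeft k b ∘ₗ LinearMap.mul' k A ∘ₗ
    (HopfAlgebra.antipode (R := k) (A := A)).rTensor A ∘ₗ EE

lemma N1_D3 (b a : A) (ha : Coalgebra.counit (R := k) a = 0) : N1 b (D3 k a) = 0 := by
  simp [N1, EE_D3, ha]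

lemma N2_D3 (b a : A) (ha : Coalgebra.counit (R := k) a = 0) : N2 b (D3 k a) = 0 := by
  simp [N2, EE_D3, ha]

lemma N1_tmul (b x y z : A) : N1 (k := k) b (x ⊗ₜ (y ⊗ₜ z)) =
    Coalgebra.counit (R := k) y • (x * b * HopfAlgebra.antipode k z) := by
  simp [N1, EE]
  congr 1; ring

lemma N2_tmul (b x y z : A) : N2 (k := k) b (x ⊗ₜ (y ⊗ₜ z)) =
    Coalgebra.counit (R := k) y • (HopfAlgebra.antipode k x * b * z) := by
  simp [N2, EE]
  congr 1; ring

lemma LL_JJ (hC : CommByFinite k A H ι) (φ : Module.Dual k H) (n : ℕ) :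
    ∀ (b : A), JJ (II) n ≤ (JJ (II) n).comap (LL φ (ι b) ∘ₗ D3 k) := by
  induction n with
  | zero => intro b x _; rw [JJ_zero]; trivial
  | succ n ih =>
    intro b
    have hI := aug_TS hC
    conv_lhs => rw [JJ_succ]
    refine Submodule.mul_le.2 fun m hm y hy => ?_
    have key : II ≤ ((JJ (II) (n + 1)).comap (LL φ (ι b) ∘ₗ D3 k)).comap
        (LinearMap.mulLeft k m) := by
      refine aug_le hC fun h a ha => ?_
      rw [Submodule.mem_comap, LinearMap.mulLeft_apply, ← mul_assoc]
      have hm' := (JJ_TS hI n h m hm).2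
      generalize m * h = m' at hm'
      rw [Submodule.mem_comap, LinearMap.comp_apply, D3_mul, D3_ι hC]
      have h1 : ∀ T', LL φ (ι b) (D3 k m' * TensorProduct.map ι (TensorProduct.map ι ι) T') -
          LL φ (ι (N1 b T')) (D3 k m') ∈ JJ (II) (n + 1) := by
        intro T'
        induction T' using ind3 with
        | h0 =>
          have := LL_smul φ 0 0 (D3 k m')
          rw [zero_smul, zero_smul] at this
          simp [this]
        | h1 x y z =>
          simp only [TensorProduct.map_tmul]
          rw [LL_mul, N1_tmul, map_smul, LL_smul, ← hC.ι_antipode, ← hC.ι_mul, ← hC.ι_mul]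
          have := Submodule.mul_mem_mul (Submodule.mem_comap.1 (ih (x * b * HopfAlgebra.antipode k z) hm'))
            (sub_mem_aug hC y)
          rw [← JJ_succ, mul_sub] at this
          simpa using this
        | h2 u v hu hv =>
          simp only [map_add, mul_add, LL_add]
          rw [add_sub_add_comm]
          exact add_mem hu hv
      have h2 := h1 (D3 k a)
      have := LL_smul φ 0 0 (D3 k m')
      rw [zero_smul, zero_smul] at this
      rwa [N1_D3 b a ha, map_zero, this, sub_zero] at h2
    exact key hy

lemma RR_JJ (hC : CommByFinite k A H ι) (φ : Module.Dual k H) (n : ℕ) :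
    ∀ (b : A), JJ (II) n ≤ (JJ (II) n).comap (RR φ (ι b) ∘ₗ D3 k) := by
  induction n with
  | zero => intro b x _; rw [JJ_zero]; trivial
  | succ n ih =>
    intro b
    have hI := aug_TS hC
    conv_lhs => rw [JJ_succ' hI]
    refine Submodule.mul_le.2 fun y hy m hm => ?_
    have key : II ≤ ((JJ (II) (n + 1)).comap (RR φ (ι b) ∘ₗ D3 k)).comap
        (LinearMap.mulRight k m) := by
      refine Submodule.span_le.2 ?_
      rintro _ ⟨a, h, ha, rfl⟩
      rw [SetLike.mem_coe, Submodule.mem_comap, LinearMap.mulRight_apply, mul_assoc]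
      have hm' := (JJ_TS hI n h m hm).1
      generalize h * m = m' at hm'
      rw [Submodule.mem_comap, LinearMap.comp_apply, D3_mul, D3_ι hC]
      have h1 : ∀ T', RR φ (ι b) (TensorProduct.map ι (TensorProduct.map ι ι) T' * D3 k m') -
          RR φ (ι (N2 b T')) (D3 k m') ∈ JJ (II) (n + 1) := by
        intro T'
        induction T' using ind3 with
        | h0 =>
          have := RR_smul φ 0 0 (D3 k m')
          rw [zero_smul, zero_smul] at this
          simp [this]
        | h1 x y z =>
          simp only [TensorProduct.map_tmul]
          rw [RR_mul, N2_tmul, map_smul, RR_smul, ← hC.ι_antipode, ← hC.ι_mul, ← hC.ι_mul]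
          have := Submodule.mul_mem_mul (sub_mem_aug hC y)
            (Submodule.mem_comap.1 (ih (HopfAlgebra.antipode k x * b * z) hm'))
          rw [← JJ_succ' hI, sub_mul] at this
          simpa using this
        | h2 u v hu hv =>
          simp only [map_add, add_mul, RR_add]
          rw [add_sub_add_comm]
          exact add_mem hu hv
      have h2 := h1 (D3 k a)
      have := RR_smul φ 0 0 (D3 k m')
      rw [zero_smul, zero_smul] at this
      rwa [N2_D3 b a ha, map_zero, this, sub_zero] at h2
    exact key hy

lemma adld_kill (hC : CommByFinite k A H ι) (φ f : Module.Dual k H) {n : ℕ} (hn : 0 < n)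
    (hf : ∀ x ∈ (II) ^ n, f x = 0) : ∀ x ∈ (II) ^ n, adld k H φ f x = 0 := by
  intro x hx
  rw [← JJ_pos (aug_TS hC) hn] at hf hx
  rw [adld_eq, ← hC.ι_one]
  exact hf _ (LL_JJ hC φ n 1 hx)

lemma adrd_kill (hC : CommByFinite k A H ι) (φ f : Module.Dual k H) {n : ℕ} (hn : 0 < n)
    (hf : ∀ x ∈ (II) ^ n, f x = 0) : ∀ x ∈ (II) ^ n, adrd k H φ f x = 0 := by
  intro x hx
  rw [← JJ_pos (aug_TS hC) hn] at hf hx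
  rw [adrd_eq, ← hC.ι_one]
  exact hf _ (RR_JJ hC φ n 1 hx)

end A4

end Paper6


open Paper in
/-- The tangential component
`W(H°) = {f ∈ H° : f((A⁺H)ⁿ) = 0 for some n > 0}` is a normal Hopf subalgebra
of `H°` (stable under both adjoint actions of `H°`), and `H̄*` is a normal Hopf
subalgebra of `W(H°)`. -/
theorem statement_6
    (k : Type) [Field k] [IsAlgClosed k]
    (A : Type) [CommRing A] [HopfAlgebra k A]
    (H : Type) [Ring H] [HopfAlgebra k H]
    (ι : A →ₗ[k] H)
    (hCbF : CommByFinite k A H ι) :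
    -- `W(H°)` is a subalgebra of `H°` ...
    convOne k ∈ tangential k A H ι ∧
    (∀ f g, f ∈ tangential k A H ι → g ∈ tangential k A H ι →
      f + g ∈ tangential k A H ι ∧ conv k f g ∈ tangential k A H ι) ∧
    (∀ (c : k) f, f ∈ tangential k A H ι → c • f ∈ tangential k A H ι) ∧
    -- ... closed under the antipode of `H°` ...
    (∀ f ∈ tangential k A H ι, f ∘ₗ HopfAlgebra.antipode (R := k) ∈ tangential k A H ι) ∧
    -- ... and a subcoalgebra of `H°`: `Δ°(W) ⊆ W ⊗ W` (pairing form)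
    (∀ f ∈ tangential k A H ι, ∃ (n : ℕ) (s t : Fin n → Module.Dual k H),
      (∀ i, s i ∈ tangential k A H ι ∧ t i ∈ tangential k A H ι) ∧
      ∀ x y : H, f (x * y) = ∑ i, s i x * t i y) ∧
    -- `W(H°)` is normal in `H°`: stable under both adjoint actions
    (∀ φ ∈ finDual k H, ∀ f ∈ tangential k A H ι,
      adld k H φ f ∈ tangential k A H ι ∧ adrd k H φ f ∈ tangential k A H ι) ∧
    -- `H̄*` is contained in `W(H°)` ...
    finDual k H ∩ hbarStar k A H ι ⊆ tangential k A H ι ∧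
    -- ... is a Hopf subalgebra of it ...
    convOne k ∈ finDual k H ∩ hbarStar k A H ι ∧
    (∀ f g, f ∈ finDual k H ∩ hbarStar k A H ι →
      g ∈ finDual k H ∩ hbarStar k A H ι →
      f + g ∈ finDual k H ∩ hbarStar k A H ι ∧
      conv k f g ∈ finDual k H ∩ hbarStar k A H ι) ∧
    (∀ f ∈ finDual k H ∩ hbarStar k A H ι,
      f ∘ₗ HopfAlgebra.antipode (R := k) ∈ finDual k H ∩ hbarStar k A H ι) ∧
    (∀ f ∈ finDual k H ∩ hbarStar k A H ι,
      ∃ (n : ℕ) (s t : Fin n → Module.Dual k H),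
      (∀ i, s i ∈ finDual k H ∩ hbarStar k A H ι ∧
        t i ∈ finDual k H ∩ hbarStar k A H ι) ∧
      ∀ x y : H, f (x * y) = ∑ i, s i x * t i y) ∧
    -- ... and is normal in `W(H°)`
    (∀ φ ∈ tangential k A H ι, ∀ f ∈ finDual k H ∩ hbarStar k A H ι,
      adld k H φ f ∈ finDual k H ∩ hbarStar k A H ι ∧
      adrd k H φ f ∈ finDual k H ∩ hbarStar k A H ι) := by
  have hI := Paper6.aug_TS hCbF
  have hone : convOne k ∈ finDual k H ∩ hbarStar k A H ι :=
    ⟨Paper6.fin_one, Paper6.aug_counit hCbF⟩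
  have hsub : finDual k H ∩ hbarStar k A H ι ⊆ tangential k A H ι := fun f hf =>
    ⟨hf.1, 1, one_pos, by rw [pow_one]; exact hf.2⟩
  have hpow : ∀ {m n : ℕ}, 0 < m → m ≤ n → augHIdeal k A H ι ^ n ≤ augHIdeal k A H ι ^ m := by
    intro m n hm hmn
    rw [← Paper6.JJ_pos hI hm, ← Paper6.JJ_pos hI (hm.trans_le hmn)]
    exact Paper6.JJ_anti hI hmn
  refine ⟨hsub hone, ?_, ?_, ?_, ?_, ?_, hsub, hone, ?_, ?_, ?_, ?_⟩
  · rintro f g ⟨hf, n, hn, hfn⟩ ⟨hg, m, hm, hgm⟩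
    refine ⟨⟨Paper6.fin_add hf hg, n + m, by omega, fun x hx => ?_⟩,
      ⟨Paper6.fin_conv hf hg, n + m, by omega, ?_⟩⟩
    · rw [LinearMap.add_apply, hfn x (hpow hn (by omega) hx), hgm x (hpow hm (by omega) hx),
        add_zero]
    · rw [← Paper6.JJ_pos hI hn] at hfn
      rw [← Paper6.JJ_pos hI hm] at hgm
      rw [← Paper6.JJ_pos hI (by omega : 0 < n + m)]
      exact Paper6.conv_kill f g _ _ _ hfn hgm (Paper6.comul_JJ' hI (Paper6.aug_comul hCbF) n m)
  · rintro c f ⟨hf, n, hn, hfn⟩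
    exact ⟨Paper6.fin_smul c hf, n, hn, fun x hx => by
      rw [LinearMap.smul_apply, hfn x hx, smul_zero]⟩
  · rintro f ⟨hf, n, hn, hfn⟩
    exact ⟨Paper6.fin_antipode hf, n, hn, fun x hx =>
      hfn _ (Paper6.S_pow _ (Paper6.aug_S hCbF) n hx)⟩
  · rintro f ⟨hf, n, hn, hfn⟩
    have hTS : Paper6.TS (augHIdeal k A H ι ^ n) := by
      rw [← Paper6.JJ_pos hI hn]; exact Paper6.JJ_TS hI n
    obtain ⟨N, s, t, h1, h2⟩ := Paper6.fin_coprod hf _ hTS hfn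
    exact ⟨N, s, t, fun i => ⟨⟨(h1 i).1.1, n, hn, (h1 i).1.2⟩, ⟨(h1 i).2.1, n, hn, (h1 i).2.2⟩⟩, h2⟩
  · rintro φ hφ f ⟨hf, n, hn, hfn⟩
    exact ⟨⟨Paper6.fin_adld hφ hf, n, hn, Paper6.adld_kill hCbF φ f hn hfn⟩,
      ⟨Paper6.fin_adrd hφ hf, n, hn, Paper6.adrd_kill hCbF φ f hn hfn⟩⟩
  · rintro f g ⟨hf, hf1⟩ ⟨hg, hg1⟩
    refine ⟨⟨Paper6.fin_add hf hg, fun x hx => ?_⟩, ⟨Paper6.fin_conv hf hg, ?_⟩⟩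
    · rw [LinearMap.add_apply, hf1 x hx, hg1 x hx, add_zero]
    · exact Paper6.conv_kill f g _ _ _ hf1 hg1 (Paper6.aug_comul hCbF)
  · rintro f ⟨hf, hf1⟩
    exact ⟨Paper6.fin_antipode hf, fun x hx => hf1 _ (Paper6.aug_S hCbF hx)⟩
  · rintro f ⟨hf, hf1⟩
    obtain ⟨N, s, t, h1, h2⟩ := Paper6.fin_coprod hf _ hI hf1
    exact ⟨N, s, t, fun i => ⟨(h1 i).1, (h1 i).2⟩, h2⟩
  · rintro φ ⟨hφ, -⟩ f ⟨hf, hf1⟩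
    have hf2 : ∀ x ∈ augHIdeal k A H ι ^ 1, f x = 0 := by rw [pow_one]; exact hf1
    have a := Paper6.adld_kill hCbF φ f one_pos hf2
    have b := Paper6.adrd_kill hCbF φ f one_pos hf2
    rw [pow_one] at a b
    exact ⟨⟨Paper6.fin_adld hφ hf, a⟩, ⟨Paper6.fin_adrd hφ hf, b⟩⟩
end

section
/- Let A ⊆ H be an affine commutative-by-finite Hopf algebra with A semiprime or central in H, or H pointed. Then W(H°) decomposes as a crossed product W(H°) ≅ H̄* #_σ A' for some cocycle σ and action of A' on H̄*, the isomorphism holding as algebras, as left H̄*-modules, and as right A'-comodules; moreover the coinvariants of W(H°) under the restriction of ι° equal H̄*. -/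
open TensorProduct LinearMap Coalgebra

namespace PaperAux
open Paper WithConv

section
variable {k : Type} [Field k] {A : Type} [CommRing A] [HopfAlgebra k A]
  {H : Type} [Ring H] [HopfAlgebra k H] {ι : A →ₗ[k] H}

lemma adl_conv (a h : H) :
    adl k H h a = (toConv (LinearMap.mulRight k a) *
      toConv (HopfAlgebra.antipode k (A := H))) h := by
  rw [(ℛ k h).convMul_apply]
  unfold adl
  conv_lhs => rw [← (ℛ k h).eq]
  simp

lemma adr_conv (a h : H) :
    adr k H h a = (toConv (HopfAlgebra.antipode k (A := H)) *
      toConv (LinearMap.mulLeft k a)) h := by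
  rw [(ℛ k h).convMul_apply]
  unfold adr
  conv_lhs => rw [← (ℛ k h).eq]
  simp [mul_assoc]

lemma counit_mul' (a h : H) : counit (R := k) (a * h) = counit (R := k) a * counit (R := k) h :=
  Bialgebra.counit_mul a h

lemma counit_adl (a h : H) (ha : counit (R := k) a = 0) : counit (R := k) (adl k H h a) = 0 := by
  rw [adl_conv, (ℛ k h).convMul_apply]
  simp [ha]

lemma counit_adr (a h : H) (ha : counit (R := k) a = 0) : counit (R := k) (adr k H h a) = 0 := by
  rw [adr_conv, (ℛ k h).convMul_apply]
  simp [ha]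

lemma mul_eq_adl (a h : H) :
    h * a = ∑ i ∈ (ℛ k h).index, adl k H ((ℛ k h).left i) a * (ℛ k h).right i := by
  have : toConv (LinearMap.mulRight k a) = (toConv (LinearMap.mulRight k a) *
      toConv (HopfAlgebra.antipode k (A := H))) * toConv LinearMap.id := by
    rw [mul_assoc, LinearMap.antipode_mul_id, mul_one]
  have h2 := congrArg (fun f => f h) this
  simp only [(ℛ k h).convMul_apply] at h2
  simp only [adl_conv]
  simpa using h2

lemma mul_eq_adr (a h : H) :
    a * h = ∑ i ∈ (ℛ k h).index, (ℛ k h).left i * adr k H ((ℛ k h).right i) a := by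
  have : toConv (LinearMap.mulLeft k a) = toConv LinearMap.id *
    (toConv (HopfAlgebra.antipode k (A := H)) * toConv (LinearMap.mulLeft k a)) := by
    rw [← mul_assoc, LinearMap.id_mul_antipode, one_mul]
  have h2 := congrArg (fun f => f h) this
  simp only [(ℛ k h).convMul_apply] at h2
  simp only [adr_conv]
  simpa using h2

lemma mem_augIdeal {a : A} : a ∈ augIdeal k A ↔ counit (R := k) a = 0 := by
  unfold augIdeal
  rw [RingHom.mem_ker]
  rfl

/-- image of an ideal -/
def imI (ι : A →ₗ[k] H) (J : Ideal A) : Submodule k H := (J.restrictScalars k).map ι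

lemma leftMul_eq (J : Ideal A) : leftMul k A H ι J = ⊤ * imI ι J := by
  apply le_antisymm
  · unfold leftMul
    rw [Submodule.span_le]
    rintro _ ⟨h, a, ha, rfl⟩
    exact Submodule.mul_mem_mul trivial ⟨a, ha, rfl⟩
  · rw [Submodule.mul_le]
    rintro h - _ ⟨a, ha, rfl⟩
    exact Submodule.subset_span ⟨h, a, ha, rfl⟩

lemma rightMul_eq (J : Ideal A) : rightMul k A H ι J = imI ι J * ⊤ := by
  apply le_antisymm
  · unfold rightMul
    rw [Submodule.span_le]
    rintro _ ⟨h, a, ha, rfl⟩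
    exact Submodule.mul_mem_mul ⟨a, ha, rfl⟩ trivial
  · rw [Submodule.mul_le]
    rintro _ ⟨a, ha, rfl⟩ h -
    exact Submodule.subset_span ⟨h, a, ha, rfl⟩

lemma augH_eq : augHIdeal k A H ι = imI ι (augIdeal k A) * ⊤ := by
  rw [← rightMul_eq]
  unfold augHIdeal rightMul
  congr 1
  ext x
  constructor
  · rintro ⟨a, h, ha, rfl⟩
    exact ⟨h, a, mem_augIdeal.2 ha, rfl⟩
  · rintro ⟨h, a, ha, rfl⟩
    exact ⟨a, h, mem_augIdeal.1 ha, rfl⟩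

lemma imI_comm (hC : CommByFinite k A H ι) :
    (⊤ : Submodule k H) * imI ι (augIdeal k A) = imI ι (augIdeal k A) * ⊤ := by
  apply le_antisymm
  · rw [Submodule.mul_le]
    rintro h - _ ⟨a, ha, rfl⟩
    rw [mul_eq_adl (k := k)]
    refine Submodule.sum_mem _ fun i _ => Submodule.mul_mem_mul ?_ trivial
    obtain ⟨b, hb⟩ := hC.normal_left ((ℛ k h).left i) a
    refine ⟨b, mem_augIdeal.2 ?_, hb⟩
    rw [← hC.ι_counit, hb]
    exact counit_adl _ _ ((hC.ι_counit a).trans (mem_augIdeal.1 ha))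
  · rw [Submodule.mul_le]
    rintro _ ⟨a, ha, rfl⟩ h -
    rw [mul_eq_adr (k := k)]
    refine Submodule.sum_mem _ fun i _ => Submodule.mul_mem_mul trivial ?_
    obtain ⟨b, hb⟩ := hC.normal_right ((ℛ k h).right i) a
    refine ⟨b, mem_augIdeal.2 ?_, hb⟩
    rw [← hC.ι_counit, hb]
    exact counit_adr _ _ ((hC.ι_counit a).trans (mem_augIdeal.1 ha))

/-- bundled algebra hom -/
def iotaHom (hC : CommByFinite k A H ι) : A →ₐ[k] H := AlgHom.ofLinearMap ι hC.ι_one hC.ι_mul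

lemma imI_pow (hC : CommByFinite k A H ι) (n : ℕ) :
    imI ι (augIdeal k A ^ (n + 1)) = imI ι (augIdeal k A) ^ (n + 1) := by
  unfold imI
  have : (ι : A →ₗ[k] H) = (iotaHom hC).toLinearMap := rfl
  rw [Submodule.restrictScalars_pow (Nat.succ_ne_zero n), this, Submodule.map_pow]

lemma imI_pow_comm (hC : CommByFinite k A H ι) (n : ℕ) :
    (⊤ : Submodule k H) * imI ι (augIdeal k A) ^ n = imI ι (augIdeal k A) ^ n * ⊤ := by
  induction n with
  | zero => simp
  | succ n ih => rw [pow_succ, ← mul_assoc, ih, mul_assoc, imI_comm hC, mul_assoc]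

lemma top_mul_top' : (⊤ : Submodule k H) * ⊤ = ⊤ := by
  apply top_unique
  intro x _
  rw [← mul_one x]
  exact Submodule.mul_mem_mul trivial trivial

/-- `H m^n` -/
def U (ι : A →ₗ[k] H) (n : ℕ) : Submodule k H := leftMul k A H ι (augIdeal k A ^ n)

lemma U_succ (hC : CommByFinite k A H ι) (n : ℕ) : U ι (n+1) = ⊤ * imI ι (augIdeal k A) ^ (n+1) := by
  unfold U; rw [leftMul_eq, imI_pow hC]

lemma U_zero (hC : CommByFinite k A H ι) : U ι 0 = ⊤ := by
  apply top_unique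
  intro x _
  refine Submodule.subset_span ⟨x, 1, by simp, by rw [hC.ι_one, mul_one]⟩

lemma U_one (hC : CommByFinite k A H ι) : U ι 1 = augHIdeal k A H ι := by
  rw [augH_eq, ← imI_comm hC, U_succ hC, zero_add, pow_one]

lemma U_pow (hC : CommByFinite k A H ι) (n : ℕ) : augHIdeal k A H ι ^ (n+1) = U ι (n+1) := by
  rw [U_succ hC, augH_eq, ← imI_comm hC]
  induction n with
  | zero => simp
  | succ n ih =>
    rw [pow_succ, ih, pow_succ _ (n+1), ← mul_assoc, mul_assoc ⊤ _ ⊤, ← imI_pow_comm hC,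
      ← mul_assoc, top_mul_top', mul_assoc]

lemma U_right (hC : CommByFinite k A H ι) (n : ℕ) :
    U ι n = rightMul k A H ι (augIdeal k A ^ n) := by
  cases n with
  | zero =>
    rw [U_zero hC]
    symm
    apply top_unique
    intro x _
    refine Submodule.subset_span ⟨x, 1, by simp, by rw [hC.ι_one, one_mul]⟩
  | succ n =>
    rw [U_succ hC, rightMul_eq, imI_pow hC, imI_pow_comm hC]

lemma mul_mem_U {n : ℕ} (h : H) {x : H} (hx : x ∈ U ι n) : h * x ∈ U ι n := by
  unfold U at *
  rw [leftMul_eq] at *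
  have := Submodule.mul_mem_mul (show h ∈ (⊤ : Submodule k H) from trivial) hx
  rwa [← mul_assoc, top_mul_top'] at this

lemma U_mul_mem (hC : CommByFinite k A H ι) {n : ℕ} (h : H) {x : H} (hx : x ∈ U ι n) :
    x * h ∈ U ι n := by
  rw [U_right hC] at *
  rw [rightMul_eq] at *
  have := Submodule.mul_mem_mul hx (show h ∈ (⊤ : Submodule k H) from trivial)
  rwa [mul_assoc, top_mul_top'] at this

lemma mem_U {n : ℕ} (h : H) {a : A} (ha : a ∈ augIdeal k A ^ n) : h * ι a ∈ U ι n :=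
  Submodule.subset_span ⟨h, a, ha, rfl⟩

lemma U_le_iff {n : ℕ} {M : Type} [AddCommGroup M] [Module k M] {f : H →ₗ[k] M} :
    U ι n ≤ LinearMap.ker f ↔ ∀ h, ∀ a ∈ augIdeal k A ^ n, f (h * ι a) = 0 := by
  unfold U leftMul
  rw [Submodule.span_le]
  constructor
  · intro H1 h a ha
    exact H1 ⟨h, a, ha, rfl⟩
  · rintro H1 _ ⟨h, a, ha, rfl⟩
    exact H1 h a ha

lemma U_anti {m n : ℕ} (h : m ≤ n) : U ι n ≤ U ι m := by
  unfold U leftMul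
  apply Submodule.span_mono
  rintro _ ⟨h', a, ha, rfl⟩
  exact ⟨h', a, Ideal.pow_le_pow_right h ha, rfl⟩

lemma counit_U1 (hC : CommByFinite k A H ι) {x : H} (hx : x ∈ U ι 1) : counit (R := k) x = 0 := by
  have : U ι 1 ≤ LinearMap.ker (counit (R := k) (A := H)) := by
    rw [U_le_iff]
    intro h a ha
    rw [pow_one, mem_augIdeal] at ha
    rw [counit_mul', hC.ι_counit, ha, mul_zero]
  exact this hx

/-- Artin-Rees. -/
lemma artinRees (hC : CommByFinite k A H ι) (l : ℕ) :
    ∃ n, 0 < n ∧ ∀ a : A, ι a ∈ U ι n → a ∈ augIdeal k A ^ l := by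
  have hft : Algebra.FiniteType k A := ⟨by
    obtain ⟨s, hs⟩ := hC.affine
    exact ⟨s, hs⟩⟩
  have hN : IsNoetherianRing A := Algebra.FiniteType.isNoetherianRing k A
  let _ : Module A H := Module.compHom H (iotaHom hC).toRingHom
  have hsm : ∀ (a : A) (h : H), a • h = ι a * h := fun a h => rfl
  have hfin : Module.Finite A H := by
    obtain ⟨s, hs⟩ := hC.finiteOver
    refine ⟨⟨s, top_unique ?_⟩⟩
    intro x _
    have hx : x ∈ (⊤ : Submodule k H) := trivial
    rw [← hs] at hx
    refine Submodule.span_induction ?_ ?_ ?_ ?_ hx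
    · rintro _ ⟨a, y, hy, rfl⟩
      rw [← hsm]
      exact Submodule.smul_mem _ _ (Submodule.subset_span hy)
    · exact Submodule.zero_mem _
    · intro x y _ _ hx hy; exact Submodule.add_mem _ hx hy
    · intro c x _ hx
      have : c • x = (algebraMap k A c) • x := by
        rw [hsm]
        have : ι (algebraMap k A c) = algebraMap k H c := (iotaHom hC).commutes c
        rw [this, Algebra.smul_def]
      rw [this]
      exact Submodule.smul_mem _ _ hx
  let f : A →ₗ[A] H := { toFun := ι, map_add' := map_add ι, map_smul' := fun a b => hC.ι_mul a b }
  obtain ⟨c, hc⟩ := Ideal.exists_pow_inf_eq_pow_smul (augIdeal k A) (LinearMap.range f)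
  refine ⟨l + c + 1, by omega, fun a ha => ?_⟩
  have h1 : ι a ∈ (augIdeal k A ^ (l + c + 1) • ⊤ : Submodule A H) := by
    rw [U_right hC] at ha
    refine Submodule.span_induction ?_ ?_ ?_ ?_ ha
    · rintro _ ⟨h, b, hb, rfl⟩
      rw [← hsm]
      exact Submodule.smul_mem_smul hb trivial
    · exact Submodule.zero_mem _
    · intro x y _ _ hx hy; exact Submodule.add_mem _ hx hy
    · intro d x _ hx
      have : d • x = (algebraMap k A d) • x := by
        rw [hsm]
        have : ι (algebraMap k A d) = algebraMap k H d := (iotaHom hC).commutes d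
        rw [this, Algebra.smul_def]
      rw [this]
      exact Submodule.smul_mem _ _ hx
  have h2 : ι a ∈ (augIdeal k A ^ (l + c + 1) • ⊤ ⊓ LinearMap.range f : Submodule A H) :=
    ⟨h1, a, rfl⟩
  rw [hc _ (by omega)] at h2
  have h3 : ι a ∈ (augIdeal k A ^ (l + c + 1 - c) • LinearMap.range f : Submodule A H) :=
    Submodule.smul_mono le_rfl inf_le_right h2
  rw [LinearMap.range_eq_map, ← Submodule.map_smul''] at h3
  obtain ⟨b, hb, hab⟩ := h3
  have : b = a := hC.ι_inj hab
  subst this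
  have hb' : b ∈ augIdeal k A ^ (l + c + 1 - c) := by simpa using hb
  exact Ideal.pow_le_pow_right (by omega) hb'

lemma finite_quot_pow (hC : CommByFinite k A H ι) (n : ℕ) :
    FiniteDimensional k (A ⧸ augIdeal k A ^ n) := by
  have hft : Algebra.FiniteType k A := ⟨by
    obtain ⟨s, hs⟩ := hC.affine
    exact ⟨s, hs⟩⟩
  have hN : IsNoetherianRing A := Algebra.FiniteType.isNoetherianRing k A
  obtain ⟨s, hs⟩ := (isNoetherianRing_iff_ideal_fg A).1 hN (augIdeal k A)
  -- A = V + m^n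
  have key : ∃ V : Submodule k A, V.FG ∧ ∀ a : A, ∃ v ∈ V, a - v ∈ augIdeal k A ^ n := by
    induction n with
    | zero => exact ⟨⊥, Submodule.fg_bot, fun a => ⟨0, by simp, by simp⟩⟩
    | succ n ih =>
      obtain ⟨V, hV, hVA⟩ := ih
      let V' : Submodule k A := Submodule.span k {1} ⊔ Submodule.span k (s : Set A) * V
      refine ⟨V', ?_, ?_⟩
      · refine Submodule.FG.sup (Submodule.fg_span (Set.finite_singleton _)) ?_
        exact Submodule.FG.mul (Submodule.fg_span s.finite_toSet) hV
      · have hm : ∀ a ∈ augIdeal k A, ∃ v ∈ Submodule.span k (s : Set A) * V,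
            a - v ∈ augIdeal k A ^ (n+1) := by
          intro a ha
          rw [← hs] at ha
          refine Submodule.span_induction ?_ ?_ ?_ ?_
            (p := fun a _ => ∀ b : A, ∃ v ∈ Submodule.span k (s : Set A) * V,
            b * a - v ∈ augIdeal k A ^ (n+1)) ha 1 |> (by simpa using ·)
          · intro x hx b
            obtain ⟨v, hv, hbv⟩ := hVA b
            refine ⟨x * v, Submodule.mul_mem_mul (Submodule.subset_span hx) hv, ?_⟩
            rw [mul_comm b x, ← mul_sub, pow_succ']
            refine Ideal.mul_mem_mul ?_ hbv
            rw [← hs]; exact Submodule.subset_span hx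
          · intro b; exact ⟨0, zero_mem _, by simp⟩
          · intro x y _ _ hx hy b
            obtain ⟨v, hv, h1⟩ := hx b
            obtain ⟨w, hw, h2⟩ := hy b
            refine ⟨v + w, add_mem hv hw, ?_⟩
            have := add_mem h1 h2
            convert this using 1; ring
          · intro c x _ hx b
            obtain ⟨v, hv, h1⟩ := hx (b * c)
            refine ⟨v, hv, ?_⟩
            convert h1 using 1; simp [mul_assoc]
        intro a
        obtain ⟨v, hv, h1⟩ := hm (a - algebraMap k A (counit (R := k) a)) (by
          rw [mem_augIdeal]; simp)
        refine ⟨algebraMap k A (counit (R := k) a) + v, ?_, ?_⟩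
        · refine Submodule.add_mem_sup ?_ hv
          rw [Algebra.algebraMap_eq_smul_one]
          exact Submodule.smul_mem _ _ (Submodule.subset_span rfl)
        · convert h1 using 1; ring
  obtain ⟨V, hV, hVA⟩ := key
  have : Module.Finite k V := Module.Finite.iff_fg.2 hV
  refine Module.Finite.of_surjective
    ((Ideal.Quotient.mkₐ k (augIdeal k A ^ n)).toLinearMap ∘ₗ V.subtype) ?_
  intro x
  obtain ⟨a, rfl⟩ := Ideal.Quotient.mk_surjective x
  obtain ⟨v, hv, h⟩ := hVA a
  refine ⟨⟨v, hv⟩, ?_⟩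
  exact ((Ideal.Quotient.mk_eq_mk_iff_sub_mem _ _).2 h).symm
end
end PaperAux

namespace PaperAux
open Paper WithConv

section
variable {k : Type} [Field k] {A : Type} [CommRing A] [HopfAlgebra k A]
  {H : Type} [Ring H] [HopfAlgebra k H] {ι : A →ₗ[k] H}

lemma antipode_antipode (a : A) : HopfAlgebra.antipode k (HopfAlgebra.antipode k a) = a := by
  have h1 : toConv (HopfAlgebra.antipode k (A := A)) *
      toConv (HopfAlgebra.antipode k (A := A) ∘ₗ HopfAlgebra.antipode k) = 1 := by
    have := LinearMap.algHom_comp_convMul_distrib (HopfAlgebra.antipodeAlgHom k A)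
      (toConv LinearMap.id) (toConv (HopfAlgebra.antipode k (A := A)))
    rw [LinearMap.id_mul_antipode] at this
    apply WithConv.ext
    refine Eq.trans this.symm ?_
    ext x
    simp only [LinearMap.convOne_def, LinearMap.comp_apply, Algebra.linearMap_apply]
    exact (HopfAlgebra.antipodeAlgHom k A).commutes _
  have h2 := left_inv_eq_right_inv (LinearMap.id_mul_antipode (R := k) (C := A)) h1
  exact (congrArg (fun f => f a) h2).symm

lemma antipode_mem_pow (n : ℕ) {a : A} (ha : a ∈ augIdeal k A ^ n) :
    HopfAlgebra.antipode k a ∈ augIdeal k A ^ n := by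
  have h1 : (augIdeal k A).map (HopfAlgebra.antipodeAlgHom k A) ≤ augIdeal k A := by
    rw [Ideal.map_le_iff_le_comap]
    intro x hx
    rw [Ideal.mem_comap, mem_augIdeal]
    rw [mem_augIdeal] at hx
    simpa using hx
  have h2 : (augIdeal k A ^ n).map (HopfAlgebra.antipodeAlgHom k A) ≤ augIdeal k A ^ n := by
    rw [Ideal.map_pow]
    exact Ideal.pow_right_mono h1 n
  exact h2 (Ideal.mem_map_of_mem _ ha)

/-- The finite set of topological generators. -/
lemma exists_gens (hC : CommByFinite k A H ι) :
    ∃ (s : ℕ) (e : Option (Fin s) → H), FiniteDimensional k (H ⧸ U ι 1) ∧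
      s + 1 ≤ Module.finrank k (H ⧸ U ι 1) ∧ e none = 1 ∧
      (∀ j, counit (R := k) (e (some j)) = 0) ∧
      ∀ h : H, ∃ c : Option (Fin s) → k, h - ∑ i, c i • e i ∈ U ι 1 := by
  have hfd : FiniteDimensional k (H ⧸ U ι 1) := by
    obtain ⟨s, hs⟩ := hC.finiteOver
    classical
    refine ⟨⟨s.image (U ι 1).mkQ, top_unique ?_⟩⟩
    rintro x -
    obtain ⟨x, rfl⟩ := (U ι 1).mkQ_surjective x
    have hx : x ∈ (⊤ : Submodule k H) := trivial
    rw [← hs] at hx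
    refine Submodule.span_induction ?_ ?_ ?_ ?_ hx
    · rintro _ ⟨a, y, hy, rfl⟩
      have : (U ι 1).mkQ (ι a * y) = counit (R := k) a • (U ι 1).mkQ y := by
        rw [← map_smul, ← sub_eq_zero, ← map_sub, Submodule.mkQ_apply, Submodule.Quotient.mk_eq_zero,
          U_right hC]
        refine Submodule.subset_span ⟨y, a - algebraMap k A (counit (R := k) a), ?_, ?_⟩
        · rw [pow_one, mem_augIdeal]; simp
        · have : ι (algebraMap k A (counit (R := k) a)) = algebraMap k H (counit (R := k) a) :=
            (iotaHom hC).commutes _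
          rw [map_sub, this, sub_mul, Algebra.smul_def]
      rw [this]
      refine Submodule.smul_mem _ _ (Submodule.subset_span ?_)
      simp only [Finset.coe_image]
      exact ⟨y, hy, rfl⟩
    · rw [map_zero]; exact Submodule.zero_mem _
    · intro x y _ _ hx hy; rw [map_add]; exact Submodule.add_mem _ hx hy
    · intro c x _ hx; rw [map_smul]; exact Submodule.smul_mem _ _ hx
  let eb : (H ⧸ U ι 1) →ₗ[k] k := (U ι 1).liftQ counit (fun x hx => counit_U1 hC hx)
  have heb : ∀ h, eb ((U ι 1).mkQ h) = counit (R := k) h := fun h => rfl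
  have hsurj : LinearMap.range eb = ⊤ := by
    rw [LinearMap.range_eq_top]
    intro c
    refine ⟨(U ι 1).mkQ (c • 1), ?_⟩
    rw [heb]; simp
  have hrk := LinearMap.finrank_range_add_finrank_ker eb
  rw [hsurj, finrank_top, Module.finrank_self] at hrk
  let b := Module.finBasis k (LinearMap.ker eb)
  choose f hf using fun j => (U ι 1).mkQ_surjective (b j : H ⧸ U ι 1)
  refine ⟨_, fun i => i.elim 1 f, hfd, by omega, rfl, ?_, ?_⟩
  · intro j
    change counit (R := k) (f j) = 0
    rw [← heb, hf]
    exact (b j).2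
  · intro h
    let y : LinearMap.ker eb := ⟨(U ι 1).mkQ (h - counit (R := k) h • 1), by
      rw [LinearMap.mem_ker, heb]; simp⟩
    refine ⟨fun i => i.elim (counit (R := k) h) (fun j => b.repr y j), ?_⟩
    have hy := congrArg (Subtype.val) (b.sum_repr y)
    rw [← Submodule.Quotient.mk_eq_zero, ← Submodule.mkQ_apply, Fintype.sum_option]
    simp only [Option.elim]
    rw [← sub_sub, map_sub, sub_eq_zero]
    change (y : H ⧸ U ι 1) = _
    rw [map_sum]
    simp only [map_smul, hf]
    rw [← hy]
    simp only [Submodule.coe_sum, Submodule.coe_smul]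

/-- `H = ∑ e_i A + H m^n` -/
lemma gens_span (hC : CommByFinite k A H ι) {s : ℕ} {e : Option (Fin s) → H}
    (he : ∀ h : H, ∃ c : Option (Fin s) → k, h - ∑ i, c i • e i ∈ U ι 1) (n : ℕ) (h : H) :
    ∃ a : Option (Fin s) → A, h - ∑ i, e i * ι (a i) ∈ U ι n := by
  induction n generalizing h with
  | zero => exact ⟨0, by rw [U_zero hC]; trivial⟩
  | succ n ih =>
    have h1 : ∀ x ∈ U ι 1, ∃ a : Option (Fin s) → A, x - ∑ i, e i * ι (a i) ∈ U ι (n+1) := by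
      intro x hx
      refine Submodule.span_induction ?_ ?_ ?_ ?_ hx
      · rintro _ ⟨g, b, hb, rfl⟩
        obtain ⟨a, ha⟩ := ih g
        refine ⟨fun i => a i * b, ?_⟩
        simp only [hC.ι_mul, ← mul_assoc, ← Finset.sum_mul, ← sub_mul]
        rw [U_succ hC, pow_succ, ← mul_assoc]
        refine Submodule.mul_mem_mul ?_ ⟨b, by simpa using hb, rfl⟩
        cases n with
        | zero => simp
        | succ n => rwa [← U_succ hC]
      · exact ⟨0, by simp⟩
      · rintro x y _ _ ⟨a, ha⟩ ⟨b, hb⟩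
        refine ⟨a + b, ?_⟩
        have := add_mem ha hb
        convert this using 1
        simp [mul_add, Finset.sum_add_distrib]; abel
      · rintro c x _ ⟨a, ha⟩
        refine ⟨c • a, ?_⟩
        have := (U ι (n+1)).smul_mem c ha
        convert this using 1
        simp [smul_sub, Finset.smul_sum]
    obtain ⟨c, hc⟩ := he h
    obtain ⟨a, ha⟩ := h1 _ hc
    refine ⟨fun i => algebraMap k A (c i) + a i, ?_⟩
    convert ha using 1
    have : ∀ c : k, ι (algebraMap k A c) = algebraMap k H c := (iotaHom hC).commutes
    simp only [map_add, this, mul_add, Finset.sum_add_distrib, ← Algebra.commutes, ← Algebra.smul_def]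
    abel

lemma finite_quot_U (hC : CommByFinite k A H ι) (n : ℕ) : FiniteDimensional k (H ⧸ U ι n) := by
  obtain ⟨s, e, -, -, -, -, he⟩ := exists_gens hC
  have := finite_quot_pow hC n
  let g (i : Option (Fin s)) : (A ⧸ augIdeal k A ^ n) →ₗ[k] H ⧸ U ι n :=
    ((augIdeal k A ^ n).restrictScalars k).liftQ
      ((U ι n).mkQ ∘ₗ LinearMap.mulLeft k (e i) ∘ₗ ι) (by
        intro a ha
        rw [LinearMap.mem_ker]
        simp only [LinearMap.comp_apply, Submodule.mkQ_apply, Submodule.Quotient.mk_eq_zero,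
          LinearMap.mulLeft_apply]
        exact mem_U _ ha)
  let G : (Option (Fin s) → A ⧸ augIdeal k A ^ n) →ₗ[k] H ⧸ U ι n :=
    ∑ i, g i ∘ₗ LinearMap.proj i
  refine Module.Finite.of_surjective G ?_
  intro x
  obtain ⟨h, rfl⟩ := (U ι n).mkQ_surjective x
  obtain ⟨a, ha⟩ := gens_span hC he n h
  refine ⟨fun i => Ideal.Quotient.mk _ (a i), ?_⟩
  rw [← Submodule.Quotient.mk_eq_zero, ← Submodule.mkQ_apply, map_sub, sub_eq_zero] at ha
  rw [ha]
  simp only [G, LinearMap.sum_apply, LinearMap.comp_apply, LinearMap.proj_apply, map_sum]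
  rfl
end
end PaperAux

namespace PaperAux
open Paper WithConv

section
variable {k : Type} [Field k] {A : Type} [CommRing A] [HopfAlgebra k A]
  {H : Type} [Ring H] [HopfAlgebra k H] {ι : A →ₗ[k] H}

lemma comul_mul_iota (hC : CommByFinite k A H ι) (h : H) (a : A) :
    comul (R := k) (h * ι a) = ∑ i ∈ (ℛ k h).index, ∑ j ∈ (ℛ k a).index,
      ((ℛ k h).left i * ι ((ℛ k a).left j)) ⊗ₜ[k] ((ℛ k h).right i * ι ((ℛ k a).right j)) := by
  rw [Bialgebra.comul_mul, hC.ι_comul]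
  conv_lhs => rw [← (ℛ k h).eq, ← (ℛ k a).eq]
  simp [Finset.sum_mul_sum]

lemma sum_counit_right {C : Type} [AddCommGroup C] [Module k C] [Coalgebra k C] (a : C) :
    ∑ j ∈ (ℛ k a).index, counit (R := k) ((ℛ k a).right j) • (ℛ k a).left j = a := by
  have := congrArg (TensorProduct.rid k C) (sum_tmul_counit_eq (ℛ k a))
  simpa only [map_sum, TensorProduct.rid_tmul, one_smul] using this

lemma mk_mul_iota (hC : CommByFinite k A H ι) (v : H) (b : A) :
    (U ι 1).mkQ (v * ι b) = counit (R := k) b • (U ι 1).mkQ v := by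
  rw [← map_smul, ← sub_eq_zero, ← map_sub, Submodule.mkQ_apply, Submodule.Quotient.mk_eq_zero]
  have : v * ι b - counit (R := k) b • v = v * ι (b - algebraMap k A (counit (R := k) b)) := by
    have : ι (algebraMap k A (counit (R := k) b)) = algebraMap k H (counit (R := k) b) :=
      (iotaHom hC).commutes _
    rw [map_sub, this, mul_sub, Algebra.smul_def, Algebra.commutes]
  rw [this]
  apply mem_U
  rw [pow_one, mem_augIdeal]; simp

/-- the twisting map -/
noncomputable def Psi (ι : A →ₗ[k] H) (n : ℕ) :
    H ⊗[k] H →ₗ[k] (H ⧸ U ι n) ⊗[k] (H ⧸ U ι 1) :=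
  TensorProduct.map ((U ι n).mkQ ∘ₗ LinearMap.mul' k H) (U ι 1).mkQ ∘ₗ
    (TensorProduct.assoc k H H H).symm.toLinearMap ∘ₗ
    LinearMap.lTensor H (LinearMap.rTensor H (HopfAlgebra.antipode k) ∘ₗ comul)

lemma Psi_sum (n : ℕ) (x v : H) : Psi ι n (x ⊗ₜ v) = ∑ i ∈ (ℛ k v).index,
    (U ι n).mkQ (x * HopfAlgebra.antipode k ((ℛ k v).left i)) ⊗ₜ (U ι 1).mkQ ((ℛ k v).right i) := by
  unfold Psi
  simp only [LinearMap.comp_apply, LinearMap.lTensor_tmul]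
  conv_lhs => rw [← (ℛ k v).eq]
  simp [TensorProduct.tmul_sum]

lemma Psi_mul (hC : CommByFinite k A H ι) (n : ℕ) (x v : H) (b : A) :
    Psi ι n (x ⊗ₜ (v * ι b)) = Psi ι n ((x * ι (HopfAlgebra.antipode k b)) ⊗ₜ v) := by
  rw [Psi_sum n _ v]
  unfold Psi
  simp only [LinearMap.comp_apply, LinearMap.lTensor_tmul]
  rw [comul_mul_iota hC]
  simp only [map_sum, TensorProduct.tmul_sum, LinearMap.rTensor_tmul, LinearEquiv.coe_coe,
    TensorProduct.assoc_symm_tmul, TensorProduct.map_tmul, LinearMap.comp_apply,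
    LinearMap.mul'_apply, mk_mul_iota hC]
  refine Finset.sum_congr rfl fun i _ => ?_
  conv_rhs => rw [← sum_counit_right (k := k) b]
  simp only [map_sum, Finset.mul_sum, Finset.sum_mul, TensorProduct.sum_tmul, map_smul,
    mul_smul_comm, smul_mul_assoc, TensorProduct.tmul_smul, TensorProduct.smul_tmul',
    HopfAlgebra.antipode_mul_antidistrib, hC.ι_antipode, mul_assoc]

lemma Psi_surj (n : ℕ) : Function.Surjective (Psi (k := k) ι n) := by
  have key : Psi (k := k) ι n ∘ₗ LinearMap.rTensor H (LinearMap.mul' k H) ∘ₗ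
      (TensorProduct.assoc k H H H).symm.toLinearMap ∘ₗ LinearMap.lTensor H comul =
      TensorProduct.map (U ι n).mkQ (U ι 1).mkQ := by
    ext x v
    have h1 := coassoc_symm_apply (R := k) v
    let Φ : (H ⊗[k] H) ⊗[k] H →ₗ[k] (H ⧸ U ι n) ⊗[k] (H ⧸ U ι 1) :=
      TensorProduct.map ((U ι n).mkQ ∘ₗ LinearMap.mulLeft k x ∘ₗ LinearMap.mul' k H ∘ₗ
        LinearMap.lTensor H (HopfAlgebra.antipode k)) (U ι 1).mkQ
    have h2 : ∀ t : H ⊗[k] H, Psi (k := k) ι n (LinearMap.rTensor H (LinearMap.mul' k H)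
        ((TensorProduct.assoc k H H H).symm (x ⊗ₜ t))) =
        Φ ((TensorProduct.assoc k H H H).symm (LinearMap.lTensor H comul t)) := by
      intro t
      induction t with
      | zero => simp
      | add a b ha hb => simp only [TensorProduct.tmul_add, map_add, ha, hb]
      | tmul a b =>
        simp only [TensorProduct.assoc_symm_tmul, LinearMap.rTensor_tmul, LinearMap.mul'_apply,
          LinearMap.lTensor_tmul]
        rw [Psi_sum]
        conv_rhs => rw [← (ℛ k b).eq]
        simp [Φ, TensorProduct.tmul_sum, mul_assoc]
    have h3 : Φ (LinearMap.rTensor H comul (comul v)) = (U ι n).mkQ x ⊗ₜ (U ι 1).mkQ v := by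
      conv_rhs => rw [← sum_counit_smul (R := k) (ℛ k v)]
      conv_lhs => rw [← (ℛ k v).eq]
      simp [Φ, TensorProduct.tmul_sum, HopfAlgebra.mul_antipode_lTensor_comul_apply,
        ← Algebra.commutes, ← Algebra.smul_def, TensorProduct.smul_tmul']
    simp only [TensorProduct.AlgebraTensorModule.curry_apply, TensorProduct.curry_apply,
      LinearMap.coe_restrictScalars, LinearMap.comp_apply, LinearMap.lTensor_tmul,
      LinearEquiv.coe_coe, TensorProduct.map_tmul]
    rw [h2, h1, h3]
  have hs := TensorProduct.map_surjective (U ι n).mkQ_surjective (U (k := k) ι 1).mkQ_surjective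
  rw [← key] at hs
  exact Function.Surjective.of_comp hs

lemma key_lemma (hC : CommByFinite k A H ι) {s : ℕ} {e : Option (Fin s) → H}
    (hfd : FiniteDimensional k (H ⧸ U ι 1))
    (hs : s + 1 ≤ Module.finrank k (H ⧸ U ι 1))
    (he : ∀ h : H, ∃ c : Option (Fin s) → k, h - ∑ i, c i • e i ∈ U ι 1) (n : ℕ)
    (a : Option (Fin s) → A) (ha : ∑ i, e i * ι (a i) ∈ U ι n) (i : Option (Fin s)) :
    ι (HopfAlgebra.antipode k (a i)) ∈ U ι n := by
  have hM := finite_quot_U hC n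
  have hker : ∀ y ∈ U ι n, ∀ v, Psi ι n (y ⊗ₜ v) = 0 := by
    intro y hy v
    rw [Psi_sum]
    refine Finset.sum_eq_zero fun i _ => ?_
    rw [Submodule.mkQ_apply, (Submodule.Quotient.mk_eq_zero _).2 (U_mul_mem hC _ hy),
      TensorProduct.zero_tmul]
  let g (i : Option (Fin s)) : (H ⧸ U ι n) →ₗ[k] (H ⧸ U ι n) ⊗[k] (H ⧸ U ι 1) :=
    (U ι n).liftQ (Psi ι n ∘ₗ TensorProduct.mk k H H (e i)) (by
      rw [U_le_iff]
      intro h b hb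
      simp only [LinearMap.comp_apply, TensorProduct.mk_apply]
      rw [Psi_mul hC]
      exact hker _ (mem_U _ (antipode_mem_pow n hb)) _)
  have hg : ∀ i v, g i ((U ι n).mkQ v) = Psi ι n (e i ⊗ₜ v) := fun i v => rfl
  let G : (Option (Fin s) → H ⧸ U ι n) →ₗ[k] (H ⧸ U ι n) ⊗[k] (H ⧸ U ι 1) :=
    ∑ i, g i ∘ₗ LinearMap.proj i
  have hG : ∀ v : Option (Fin s) → H, G (fun i => (U ι n).mkQ (v i)) =
      ∑ i, Psi ι n (e i ⊗ₜ v i) := by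
    intro v
    simp only [G, LinearMap.sum_apply, LinearMap.comp_apply, LinearMap.proj_apply, hg]
  have hrel : ∀ (b : Option (Fin s) → A) (v : H),
      Psi ι n ((∑ i, e i * ι (b i)) ⊗ₜ v) =
        G (fun i => (U ι n).mkQ (v * ι (HopfAlgebra.antipode k (b i)))) := by
    intro b v
    rw [hG, TensorProduct.sum_tmul, map_sum]
    refine Finset.sum_congr rfl fun i _ => ?_
    rw [Psi_mul hC, antipode_antipode]
  have hsurj : Function.Surjective G := by
    rw [← LinearMap.range_eq_top]
    apply top_unique
    rintro y -
    obtain ⟨t, rfl⟩ := Psi_surj (k := k) (ι := ι) n y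
    induction t with
    | zero => simp
    | add a b ha hb => rw [map_add]; exact Submodule.add_mem _ ha hb
    | tmul x v =>
      obtain ⟨b, hb⟩ := gens_span hC he n x
      have := hker _ hb v
      rw [TensorProduct.sub_tmul, map_sub, sub_eq_zero] at this
      rw [this, hrel]
      exact ⟨_, rfl⟩
  have hinj : Function.Injective G := by
    have h1 : Module.finrank k (Option (Fin s) → H ⧸ U ι n) ≤
        Module.finrank k ((H ⧸ U ι n) ⊗[k] (H ⧸ U ι 1)) := by
      rw [Module.finrank_tensorProduct, Module.finrank_pi_fintype]
      simp only [Finset.sum_const, Finset.card_univ, Fintype.card_option, Fintype.card_fin,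
        smul_eq_mul]
      rw [mul_comm]
      exact Nat.mul_le_mul_left _ hs
    have h2 := LinearMap.finrank_range_add_finrank_ker G
    rw [LinearMap.range_eq_top.2 hsurj, finrank_top] at h2
    rw [← LinearMap.ker_eq_bot, ← Submodule.finrank_eq_zero (R := k)]
    omega
  have h0 := hker _ ha 1
  rw [hrel] at h0
  have h1 := hinj (h0.trans (map_zero G).symm)
  have h2 := congrFun h1 i
  simp only [one_mul, Pi.zero_apply, Submodule.mkQ_apply] at h2
  exact (Submodule.Quotient.mk_eq_zero _).1 h2
end
end PaperAux

namespace PaperAux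
open Paper WithConv

section
variable {k : Type} [Field k] {A : Type} [CommRing A] [HopfAlgebra k A]
  {H : Type} [Ring H] [HopfAlgebra k H] {ι : A →ₗ[k] H}

/-- truncations of `A` -/
abbrev Bq (k A : Type) [Field k] [CommRing A] [HopfAlgebra k A] (l : ℕ) : Type :=
  A ⧸ augIdeal k A ^ l

/-- quotient map, as an algebra map -/
noncomputable abbrev mkB (k A : Type) [Field k] [CommRing A] [HopfAlgebra k A] (l : ℕ) :
    A →ₐ[k] Bq k A l := Ideal.Quotient.mkₐ k (augIdeal k A ^ l)

lemma mkB_surj (l : ℕ) : Function.Surjective (mkB k A l) := Ideal.Quotient.mkₐ_surjective _ _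

lemma mkB_zero {l : ℕ} {a : A} : mkB k A l a = 0 ↔ a ∈ augIdeal k A ^ l :=
  Ideal.Quotient.eq_zero_iff_mem

/-- transition maps -/
noncomputable def facB (k A : Type) [Field k] [CommRing A] [HopfAlgebra k A] {l l' : ℕ}
    (h : l ≤ l') : Bq k A l' →ₐ[k] Bq k A l :=
  Ideal.Quotient.factorₐ k (Ideal.pow_le_pow_right h)

lemma facB_mk {l l' : ℕ} (h : l ≤ l') (a : A) : facB k A h (mkB k A l' a) = mkB k A l a := rfl

lemma exists_pl (hC : CommByFinite k A H ι) {s : ℕ} {e : Option (Fin s) → H}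
    (hfd : FiniteDimensional k (H ⧸ U ι 1))
    (hs : s + 1 ≤ Module.finrank k (H ⧸ U ι 1))
    (he : ∀ h : H, ∃ c : Option (Fin s) → k, h - ∑ i, c i • e i ∈ U ι 1) (l : ℕ) :
    ∃ p : H →ₗ[k] Bq k A l, (∃ n, U ι n ≤ LinearMap.ker p) ∧
      (∀ a, p (e none * ι a) = mkB k A l a) ∧ ∀ i a, p (e (some i) * ι a) = 0 := by
  classical
  obtain ⟨n, -, hn⟩ := artinRees hC l
  let E0 : (Option (Fin s) → A) →ₗ[k] H :=
    ∑ i, LinearMap.mulLeft k (e i) ∘ₗ ι ∘ₗ LinearMap.proj i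
  have hE0 : ∀ a, E0 a = ∑ i, e i * ι (a i) := by
    intro a; simp [E0, LinearMap.sum_apply]
  let E : (Option (Fin s) → A) →ₗ[k] H ⧸ U ι n := (U ι n).mkQ ∘ₗ E0
  have hE : Function.Surjective E := by
    intro y
    obtain ⟨h, rfl⟩ := (U ι n).mkQ_surjective y
    obtain ⟨a, ha⟩ := gens_span hC he n h
    refine ⟨a, ?_⟩
    rw [← hE0, ← Submodule.Quotient.mk_eq_zero, Submodule.Quotient.mk_sub, sub_eq_zero] at ha
    exact ha.symm
  let G : (Option (Fin s) → A) →ₗ[k] Bq k A l := (mkB k A l).toLinearMap ∘ₗ LinearMap.proj none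
  have hG : ∀ a b, E a = E b → G a = G b := by
    intro a b hab
    rw [← sub_eq_zero, ← map_sub] at hab ⊢
    have h1 : ∑ i, e i * ι ((a - b) i) ∈ U ι n := by
      rw [← hE0, ← Submodule.Quotient.mk_eq_zero]; exact hab
    have h2 := hn _ (key_lemma hC hfd hs he n _ h1 none)
    have h3 := antipode_mem_pow l h2
    rw [antipode_antipode] at h3
    exact mkB_zero.2 h3
  obtain ⟨r, hr⟩ := LinearMap.exists_rightInverse_of_surjective E (LinearMap.range_eq_top.2 hE)
  have hr' : ∀ y, E (r y) = y := fun y => LinearMap.congr_fun hr y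
  have hp : ∀ a, (G ∘ₗ r ∘ₗ (U ι n).mkQ) (E0 a) = mkB k A l (a none) := by
    intro a
    exact hG _ a (hr' _)
  refine ⟨G ∘ₗ r ∘ₗ (U ι n).mkQ, ⟨n, ?_⟩, ?_, ?_⟩
  · intro x hx
    have h0 : (U ι n).mkQ x = 0 := (Submodule.Quotient.mk_eq_zero _).2 hx
    change G (r ((U ι n).mkQ x)) = 0
    rw [h0, map_zero, map_zero]
  · intro a
    have := hp (Pi.single none a)
    rw [hE0] at this
    simpa [Pi.single_apply, apply_ite ι] using this
  · intro i a
    have := hp (Pi.single (some i) a)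
    rw [hE0] at this
    simpa [Pi.single_apply, apply_ite ι] using this

lemma ext_gens (hC : CommByFinite k A H ι) {s : ℕ} {e : Option (Fin s) → H}
    (he : ∀ h : H, ∃ c : Option (Fin s) → k, h - ∑ i, c i • e i ∈ U ι 1)
    {M : Type} [AddCommGroup M] [Module k M] (f g : H →ₗ[k] M)
    (hf : ∃ n, U ι n ≤ LinearMap.ker f) (hg : ∃ n, U ι n ≤ LinearMap.ker g)
    (hfg : ∀ i a, f (e i * ι a) = g (e i * ι a)) : f = g := by
  obtain ⟨n, hn⟩ := hf
  obtain ⟨n', hn'⟩ := hg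
  ext h
  obtain ⟨a, ha⟩ := gens_span hC he (max n n') h
  have h1 := hn (U_anti (le_max_left n n') ha)
  have h2 := hn' (U_anti (le_max_right n n') ha)
  rw [LinearMap.mem_ker, map_sub, sub_eq_zero, map_sum] at h1 h2
  rw [h1, h2]
  exact Finset.sum_congr rfl fun i _ => hfg i _

lemma exists_proj (hC : CommByFinite k A H ι) : ∃ p : ∀ l, H →ₗ[k] Bq k A l,
    (∀ l h a, p l (h * ι a) = p l h * mkB k A l a) ∧ (∀ l, p l 1 = 1) ∧
    (∀ l l' (hl : l ≤ l') h, facB k A hl (p l' h) = p l h) ∧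
    (∀ l h, p l h - algebraMap k _ (counit (R := k) h) ∈ (augIdeal k A).map (mkB k A l)) := by
  obtain ⟨s, e, hfd, hs, he1, hec, he⟩ := exists_gens hC
  choose p hp1 hp2 hp3 using exists_pl hC hfd hs he
  have hlin : ∀ l h a, p l (h * ι a) = p l h * mkB k A l a := by
    intro l h a
    obtain ⟨n, hn⟩ := hp1 l
    have := ext_gens hC he (p l ∘ₗ LinearMap.mulRight k (ι a))
      (LinearMap.mulRight k (mkB k A l a) ∘ₗ p l)
      ⟨n, fun x hx => hn (U_mul_mem hC _ hx)⟩
      ⟨n, fun x hx => by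
        have := hn hx
        rw [LinearMap.mem_ker] at this ⊢
        simp [this]⟩ ?_
    · exact LinearMap.congr_fun this h
    · intro i b
      simp only [LinearMap.comp_apply, LinearMap.mulRight_apply, mul_assoc, ← hC.ι_mul]
      cases i with
      | none => rw [hp2, hp2, map_mul]
      | some i => rw [hp3, hp3, zero_mul]
  refine ⟨p, hlin, ?_, ?_, ?_⟩
  · intro l
    have := hp2 l 1
    rwa [he1, hC.ι_one, mul_one, map_one (mkB k A l)] at this
  · intro l l' hl h
    obtain ⟨n, hn⟩ := hp1 l'
    have := ext_gens hC he ((facB k A hl).toLinearMap ∘ₗ p l') (p l)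
      ⟨n, fun x hx => by
        have := hn hx
        rw [LinearMap.mem_ker] at this ⊢
        simp [this]⟩ (hp1 l) ?_
    · exact LinearMap.congr_fun this h
    · intro i b
      simp only [LinearMap.comp_apply]
      cases i with
      | none => rw [hp2, hp2]; rfl
      | some i => rw [hp3, hp3]; exact map_zero _
  · intro l h
    let J : Submodule k (Bq k A l) := ((augIdeal k A).map (mkB k A l)).restrictScalars k
    by_cases hl : l = 0
    · subst hl
      have : Subsingleton (Bq k A 0) := by
        rw [Ideal.Quotient.subsingleton_iff, pow_zero, Ideal.one_eq_top]
      rw [Subsingleton.elim (p 0 h - _) 0]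
      exact Ideal.zero_mem _
    obtain ⟨n, hn⟩ := hp1 l
    have := ext_gens hC he (J.mkQ ∘ₗ p l)
      (J.mkQ ∘ₗ Algebra.linearMap k _ ∘ₗ counit)
      ⟨n, fun x hx => by
        have := hn hx
        rw [LinearMap.mem_ker] at this ⊢
        simp [this]⟩
      ⟨1, fun x hx => by
        simp [counit_U1 hC hx]⟩ ?_
    · have := LinearMap.congr_fun this h
      rw [LinearMap.comp_apply, ← sub_eq_zero, LinearMap.comp_apply, ← map_sub,
        Submodule.mkQ_apply, Submodule.Quotient.mk_eq_zero] at this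
      exact this
    · intro i b
      rw [LinearMap.comp_apply, ← sub_eq_zero, LinearMap.comp_apply, ← map_sub,
        Submodule.mkQ_apply, Submodule.Quotient.mk_eq_zero]
      change _ ∈ (augIdeal k A).map (mkB k A l)
      cases i with
      | none =>
        rw [hp2]
        have : mkB k A l b - (Algebra.linearMap k (Bq k A l) ∘ₗ counit) (e none * ι b) =
          mkB k A l (b - algebraMap k A (counit (R := k) b)) := by
          rw [map_sub, AlgHom.commutes, he1, one_mul, LinearMap.comp_apply, hC.ι_counit]
          rfl
        rw [this]
        apply Ideal.mem_map_of_mem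
        rw [mem_augIdeal]; simp
      | some i =>
        rw [hp3, LinearMap.comp_apply, counit_mul', hec]
        simp
end
end PaperAux

namespace PaperAux
open Paper WithConv

section
variable {k : Type} [Field k] {A : Type} [CommRing A] [HopfAlgebra k A]
  {H : Type} [Ring H] [HopfAlgebra k H] {ι : A →ₗ[k] H}

lemma conv_isUnit {B : Type} [CommRing B] [Algebra k B] (J : Ideal B) (l : ℕ) (hJ : J ^ l = ⊥)
    (p : WithConv (H →ₗ[k] B))
    (hp : ∀ h, p h - algebraMap k B (counit (R := k) h) ∈ J) : IsUnit p := by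
  have hq : ∀ j h, ((p - 1) ^ j) h ∈ J ^ j := by
    intro j
    induction j with
    | zero => intro h; simp
    | succ j ih =>
      intro h
      rw [pow_succ, pow_succ, (ℛ k h).convMul_apply]
      exact Ideal.sum_mem _ fun i _ => Ideal.mul_mem_mul (ih _) (hp _)
  have : IsNilpotent (p - 1) := by
    refine ⟨l, ?_⟩
    ext h
    have := hq l h
    rw [hJ] at this
    exact this
  have h2 := this.isUnit_one_add
  rwa [add_sub_cancel] at h2

lemma convMul_iota (hC : CommByFinite k A H ι) {B : Type} [Ring B] [Algebra k B]
    (f g : WithConv (H →ₗ[k] B)) (h : H) (a : A) :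
    (f * g) (h * ι a) = ∑ i ∈ (ℛ k h).index, ∑ j ∈ (ℛ k a).index,
      f ((ℛ k h).left i * ι ((ℛ k a).left j)) * g ((ℛ k h).right i * ι ((ℛ k a).right j)) := by
  rw [LinearMap.convMul_apply, comul_mul_iota hC]
  simp

lemma convMul_tmul {B : Type} [Ring B] [Algebra k B]
    (f g : WithConv (H ⊗[k] A →ₗ[k] B)) (h : H) (a : A) :
    (f * g) (h ⊗ₜ a) = ∑ i ∈ (ℛ k h).index, ∑ j ∈ (ℛ k a).index,
      f ((ℛ k h).left i ⊗ₜ ((ℛ k a).left j)) * g ((ℛ k h).right i ⊗ₜ ((ℛ k a).right j)) := by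
  rw [LinearMap.convMul_apply, TensorProduct.comul_tmul]
  conv_lhs => rw [← (ℛ k h).eq, ← (ℛ k a).eq]
  simp [TensorProduct.sum_tmul, TensorProduct.tmul_sum]
  try rw [Finset.sum_comm]

lemma inv_iota (hC : CommByFinite k A H ι) {B : Type} [CommRing B] [Algebra k B]
    (φ : A →ₐ[k] B) (p p' : WithConv (H →ₗ[k] B)) (h1 : p * p' = 1) (h2 : p' * p = 1)
    (hp : ∀ h a, p (h * ι a) = p h * φ a) (h : H) (a : A) :
    p' (h * ι a) = p' h * φ (HopfAlgebra.antipode k a) := by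
  let μ : H ⊗[k] A →ₗ[k] H := LinearMap.mul' k H ∘ₗ LinearMap.lTensor H ι
  have hμ : ∀ h a, μ (h ⊗ₜ a) = h * ι a := fun h a => by simp [μ]
  let X : WithConv (H ⊗[k] A →ₗ[k] B) := toConv (p.ofConv ∘ₗ μ)
  let Y : WithConv (H ⊗[k] A →ₗ[k] B) := toConv (p'.ofConv ∘ₗ μ)
  let Z : WithConv (H ⊗[k] A →ₗ[k] B) := toConv (LinearMap.mul' k B ∘ₗ
    TensorProduct.map p'.ofConv (φ.toLinearMap ∘ₗ HopfAlgebra.antipode k))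
  have hX : ∀ h a, X (h ⊗ₜ a) = p (h * ι a) := fun h a => by simp [X, hμ]
  have hY : ∀ h a, Y (h ⊗ₜ a) = p' (h * ι a) := fun h a => by simp [Y, hμ]
  have hZ : ∀ h a, Z (h ⊗ₜ a) = p' h * φ (HopfAlgebra.antipode k a) := fun h a => by simp [Z]
  have h1' : ∀ h, (1 : WithConv (H →ₗ[k] B)) h = algebraMap k B (counit (R := k) h) :=
    fun h => rfl
  have h1'' : ∀ h a, (1 : WithConv (H ⊗[k] A →ₗ[k] B)) (h ⊗ₜ a) =
      algebraMap k B (counit (R := k) h) * algebraMap k B (counit (R := k) a) := by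
    intro h a
    rw [LinearMap.convOne_apply, TensorProduct.counit_tmul, ← map_mul]
    congr 1
    simp [mul_comm]
  have hYX : Y * X = 1 := by
    apply WithConv.ext
    apply TensorProduct.ext'
    intro h a
    change (Y * X) (h ⊗ₜ a) = (1 : WithConv (H ⊗[k] A →ₗ[k] B)) (h ⊗ₜ a)
    rw [convMul_tmul, h1'']
    simp only [hX, hY]
    rw [← convMul_iota hC p' p h a, h2, h1', counit_mul', hC.ι_counit, map_mul]
  have hXZ : X * Z = 1 := by
    apply WithConv.ext
    apply TensorProduct.ext'
    intro h a
    change (X * Z) (h ⊗ₜ a) = (1 : WithConv (H ⊗[k] A →ₗ[k] B)) (h ⊗ₜ a)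
    rw [convMul_tmul, h1'', ← h1', ← h1, (ℛ k h).convMul_apply, ← φ.commutes,
      ← HopfAlgebra.sum_mul_antipode_eq_algebraMap_counit (ℛ k a), map_sum, Finset.sum_mul_sum]
    simp only [hX, hZ, hp, map_mul]
    refine Finset.sum_congr rfl fun i _ => Finset.sum_congr rfl fun j _ => by ring
  have := left_inv_eq_right_inv hYX hXZ
  rw [← hY, this, hZ]

lemma exists_inv (hC : CommByFinite k A H ι) (p : ∀ l, H →ₗ[k] Bq k A l)
    (hp1 : ∀ l h a, p l (h * ι a) = p l h * mkB k A l a)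
    (hp3 : ∀ l l' (hl : l ≤ l') h, facB k A hl (p l' h) = p l h)
    (hp4 : ∀ l h, p l h - algebraMap k _ (counit (R := k) h) ∈ (augIdeal k A).map (mkB k A l)) :
    ∃ p' : ∀ l, H →ₗ[k] Bq k A l, (∀ l, toConv (p l) * toConv (p' l) = 1) ∧
      (∀ l, toConv (p' l) * toConv (p l) = 1) ∧
      (∀ l l' (hl : l ≤ l') h, facB k A hl (p' l' h) = p' l h) ∧
      (∀ l h a, p' l (h * ι a) = p' l h * mkB k A l (HopfAlgebra.antipode k a)) := by
  have hu : ∀ l, ∃ q : H →ₗ[k] Bq k A l,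
      toConv (p l) * toConv q = 1 ∧ toConv q * toConv (p l) = 1 := by
    intro l
    obtain ⟨u, hu⟩ := conv_isUnit ((augIdeal k A).map (mkB k A l)) l (by
      rw [← Ideal.map_pow]
      exact Ideal.map_quotient_self _) (toConv (p l)) (hp4 l)
    refine ⟨(↑u⁻¹ : WithConv (H →ₗ[k] Bq k A l)).ofConv, ?_, ?_⟩
    · rw [← hu]; exact u.mul_inv
    · rw [← hu]; exact u.inv_mul
  choose p' h1 h2 using hu
  refine ⟨p', h1, h2, ?_, ?_⟩
  · intro l l' hl h
    have e1 : toConv (p l) = toConv ((facB k A hl).toLinearMap ∘ₗ p l') := by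
      congr 1; ext h; exact (hp3 l l' hl h).symm
    have e2 := LinearMap.algHom_comp_convMul_distrib (facB k A hl) (toConv (p' l')) (toConv (p l'))
    rw [h2 l'] at e2
    have e3 : toConv ((facB k A hl).toLinearMap ∘ₗ p' l') *
        toConv ((facB k A hl).toLinearMap ∘ₗ p l') = 1 := by
      apply WithConv.ext
      refine e2.symm.trans ?_
      ext h
      exact (facB k A hl).commutes _
    have := left_inv_eq_right_inv e3 (e1 ▸ h1 l)
    exact congrArg (fun f => f.ofConv h) this
  · intro l h a
    exact inv_iota hC (mkB k A l) (toConv (p l)) (toConv (p' l)) (h1 l) (h2 l) (hp1 l) h a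
end
end PaperAux

namespace PaperAux
open Paper WithConv

section
variable {k : Type} [Field k] {A : Type} [CommRing A] [HopfAlgebra k A]
  {H : Type} [Ring H] [HopfAlgebra k H] {ι : A →ₗ[k] H}

lemma dual_lift {α : Module.Dual k A} {n l : ℕ} (hα : ∀ x ∈ augIdeal k A ^ n, α x = 0)
    (hl : n ≤ l) : ∃ β : Module.Dual k (Bq k A l), α = β ∘ₗ (mkB k A l).toLinearMap := by
  obtain ⟨σ, hσ⟩ := LinearMap.exists_rightInverse_of_surjective (mkB k A l).toLinearMap
    (LinearMap.range_eq_top.2 (mkB_surj l))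
  refine ⟨α ∘ₗ σ, ?_⟩
  ext a
  have h1 : mkB k A l (σ (mkB k A l a)) = mkB k A l a := LinearMap.congr_fun hσ (mkB k A l a)
  rw [← sub_eq_zero, ← map_sub, mkB_zero] at h1
  have h2 := hα _ (Ideal.pow_le_pow_right hl h1)
  rw [map_sub, sub_eq_zero] at h2
  exact h2.symm

lemma exists_Gamma (q : ∀ l, H →ₗ[k] Bq k A l)
    (hq : ∀ l l' (hl : l ≤ l') h, facB k A hl (q l' h) = q l h) :
    ∃ Γ : Module.Dual k A →ₗ[k] Module.Dual k H, ∀ l (β : Module.Dual k (Bq k A l)),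
      Γ (β ∘ₗ (mkB k A l).toLinearMap) = β ∘ₗ q l := by
  have fac1 : ∀ l l' (hl : l ≤ l') (β : Module.Dual k (Bq k A l)),
      β ∘ₗ (mkB k A l).toLinearMap =
        (β ∘ₗ (facB k A hl).toLinearMap) ∘ₗ (mkB k A l').toLinearMap := fun _ _ _ _ => rfl
  have fac2 : ∀ l l' (hl : l ≤ l') (β : Module.Dual k (Bq k A l)),
      (β ∘ₗ (facB k A hl).toLinearMap) ∘ₗ q l' = β ∘ₗ q l := by
    intro l l' hl β
    ext h
    exact congrArg β (hq l l' hl h)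
  have cancel : ∀ l (β γ : Module.Dual k (Bq k A l)),
      β ∘ₗ (mkB k A l).toLinearMap = γ ∘ₗ (mkB k A l).toLinearMap → β = γ := by
    intro l β γ h
    refine LinearMap.ext fun x => ?_
    obtain ⟨a, rfl⟩ := mkB_surj l x
    exact LinearMap.congr_fun h a
  have uniq : ∀ l l' (β : Module.Dual k (Bq k A l)) (β' : Module.Dual k (Bq k A l')),
      β ∘ₗ (mkB k A l).toLinearMap = β' ∘ₗ (mkB k A l').toLinearMap →
      β ∘ₗ q l = β' ∘ₗ q l' := by
    intro l l' β β' h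
    rw [fac1 l _ (le_max_left l l'), fac1 l' _ (le_max_right l l')] at h
    rw [← fac2 l _ (le_max_left l l'), ← fac2 l' _ (le_max_right l l'), cancel _ _ _ h]
  let W : Submodule k (Module.Dual k A) :=
    { carrier := {α | ∃ l, ∃ β : Module.Dual k (Bq k A l), α = β ∘ₗ (mkB k A l).toLinearMap}
      zero_mem' := ⟨0, 0, by simp⟩
      add_mem' := by
        rintro _ _ ⟨l, β, rfl⟩ ⟨l', β', rfl⟩
        rw [fac1 l _ (le_max_left l l'), fac1 l' _ (le_max_right l l')]
        exact ⟨_, _, (LinearMap.add_comp _ _ _).symm⟩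
      smul_mem' := by
        rintro c _ ⟨l, β, rfl⟩
        exact ⟨l, c • β, rfl⟩ }
  choose lv bv hv using fun w : W => w.2
  have key : ∀ (w : W) l (β : Module.Dual k (Bq k A l)),
      (w : Module.Dual k A) = β ∘ₗ (mkB k A l).toLinearMap → bv w ∘ₗ q (lv w) = β ∘ₗ q l :=
    fun w l β h => uniq _ _ _ _ ((hv w).symm.trans h)
  let Γ0 : W →ₗ[k] Module.Dual k H :=
    { toFun := fun w => bv w ∘ₗ q (lv w)
      map_add' := by
        intro x y
        have h1 := fac1 _ _ (le_max_left (lv x) (lv y)) (bv x)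
        have h2 := fac1 _ _ (le_max_right (lv x) (lv y)) (bv y)
        rw [key (x + y) (max (lv x) (lv y)) (bv x ∘ₗ (facB k A (le_max_left _ _)).toLinearMap +
          bv y ∘ₗ (facB k A (le_max_right _ _)).toLinearMap), LinearMap.add_comp, fac2, fac2]
        rw [LinearMap.add_comp, ← h1, ← h2, ← hv, ← hv]; rfl
      map_smul' := by
        intro c x
        rw [key (c • x) (lv x) (c • bv x)]
        · rfl
        · rw [LinearMap.smul_comp, ← hv]; rfl }
  obtain ⟨Γ, hΓ⟩ := LinearMap.exists_extend Γ0
  refine ⟨Γ, fun l β => ?_⟩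
  have := LinearMap.congr_fun hΓ ⟨β ∘ₗ (mkB k A l).toLinearMap, l, β, rfl⟩
  exact this.trans (key _ _ _ rfl)

lemma conv_apply (f g : Module.Dual k H) (h : H) : conv k f g h =
    ∑ i ∈ (ℛ k h).index, f ((ℛ k h).left i) * g ((ℛ k h).right i) := by
  unfold conv
  simp only [LinearMap.comp_apply]
  conv_lhs => rw [← (ℛ k h).eq]
  simp

lemma conv_toConv (f g : Module.Dual k H) : toConv (conv k f g) = toConv f * toConv g := by
  apply WithConv.ext
  ext h
  exact (conv_apply f g h).trans ((ℛ k h).convMul_apply (toConv f) (toConv g)).symm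

lemma conv_assoc (f g e : Module.Dual k H) :
    conv k f (conv k g e) = conv k (conv k f g) e := by
  apply toConv_injective
  rw [conv_toConv, conv_toConv, conv_toConv, conv_toConv, mul_assoc]

lemma conv_iota (hC : CommByFinite k A H ι) (f g : Module.Dual k H) (h : H) (a : A) :
    conv k f g (h * ι a) = ∑ i ∈ (ℛ k h).index, ∑ j ∈ (ℛ k a).index,
      f ((ℛ k h).left i * ι ((ℛ k a).left j)) * g ((ℛ k h).right i * ι ((ℛ k a).right j)) := by
  have := convMul_iota hC (toConv f) (toConv g) h a
  rw [← conv_toConv] at this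
  exact this

lemma kill_iff (hC : CommByFinite k A H ι) (f : Module.Dual k H) :
    U ι 1 ≤ LinearMap.ker f ↔ ∀ h a, f (h * ι a) = counit (R := k) a * f h := by
  constructor
  · intro hf h a
    have := congrArg ((U ι 1).liftQ f hf) (mk_mul_iota hC h a)
    rw [map_smul] at this
    exact this
  · intro hf
    rw [U_le_iff]
    intro h a ha
    rw [pow_one, mem_augIdeal] at ha
    rw [hf, ha, zero_mul]

lemma hbar_iff (hC : CommByFinite k A H ι) (f : Module.Dual k H) :
    f ∈ hbarStar k A H ι ↔ U ι 1 ≤ LinearMap.ker f := by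
  rw [U_one hC]; rfl

lemma finDual_of_U (hC : CommByFinite k A H ι) (n : ℕ) (f : Module.Dual k H)
    (hf : U ι n ≤ LinearMap.ker f) : f ∈ finDual k H :=
  ⟨U ι n, fun h _ hx => ⟨mul_mem_U h hx, U_mul_mem hC h hx⟩, hf, finite_quot_U hC n⟩

lemma coinv (hC : CommByFinite k A H ι) :
    {f ∈ tangential k A H ι | ∀ (h : H) (a : A),
        f (h * ι a) = Coalgebra.counit (R := k) a * f h}
      = finDual k H ∩ hbarStar k A H ι := by
  ext f
  constructor
  · rintro ⟨⟨h1, -⟩, h2⟩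
    exact ⟨h1, (hbar_iff hC f).2 ((kill_iff hC f).2 h2)⟩
  · rintro ⟨h1, h2⟩
    exact ⟨⟨h1, 1, one_pos, by rw [pow_one]; exact h2⟩, (kill_iff hC f).1 ((hbar_iff hC f).1 h2)⟩

lemma counitB (l : ℕ) (hl : 0 < l) : ∃ ε : Module.Dual k (Bq k A l), ε 1 = 1 := by
  obtain ⟨β, hβ⟩ := dual_lift (k := k) (A := A) (α := counit) (n := 1) (l := l) (by
    intro x hx
    rw [pow_one] at hx
    exact mem_augIdeal.1 hx) hl
  refine ⟨β, ?_⟩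
  have := LinearMap.congr_fun hβ 1
  rw [Bialgebra.counit_one] at this
  exact this.symm

end
end PaperAux

namespace PaperAux
open Paper WithConv

section
variable {k : Type} [Field k] {A : Type} [CommRing A] [HopfAlgebra k A]
  {H : Type} [Ring H] [HopfAlgebra k H] {ι : A →ₗ[k] H}

lemma mkB_one (l : ℕ) : (mkB k A l) 1 = 1 := map_one _

lemma conv_inv_aux (q q' : ∀ l, H →ₗ[k] Bq k A l)
    (hqq : ∀ l, toConv (q l) * toConv (q' l) = 1)
    (Γ Γ' : Module.Dual k A →ₗ[k] Module.Dual k H)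
    (hΓ : ∀ l (β : Module.Dual k (Bq k A l)), Γ (β ∘ₗ (mkB k A l).toLinearMap) = β ∘ₗ q l)
    (hΓ' : ∀ l (β : Module.Dual k (Bq k A l)), Γ' (β ∘ₗ (mkB k A l).toLinearMap) = β ∘ₗ q' l)
    (α : Module.Dual k A) (hα : α ∈ Aprime k A) (n : ℕ) (u v : Fin n → Module.Dual k A)
    (huv : ∀ i, u i ∈ Aprime k A ∧ v i ∈ Aprime k A)
    (h : ∀ x y : A, α (x * y) = ∑ i, u i x * v i y) :
    (∑ i, conv k (Γ (u i)) (Γ' (v i))) = α 1 • Paper.convOne k := by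
  obtain ⟨a, -, ha⟩ := hα
  choose b hb using fun i => (huv i).1
  choose c hc using fun i => (huv i).2
  let l := a + (∑ i, b i + ∑ i, c i)
  have hbl : ∀ i, b i ≤ l := fun i => by
    have := Finset.single_le_sum (f := b) (fun _ _ => Nat.zero_le _) (Finset.mem_univ i)
    omega
  have hcl : ∀ i, c i ≤ l := fun i => by
    have := Finset.single_le_sum (f := c) (fun _ _ => Nat.zero_le _) (Finset.mem_univ i)
    omega
  obtain ⟨α', hα'⟩ := dual_lift ha (show a ≤ l by omega)
  choose u' hu' using fun i => dual_lift (hb i).2 (hbl i)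
  choose v' hv' using fun i => dual_lift (hc i).2 (hcl i)
  have hmul : ∀ x y, α' (x * y) = ∑ i, u' i x * v' i y := by
    intro x y
    obtain ⟨x, rfl⟩ := mkB_surj l x
    obtain ⟨y, rfl⟩ := mkB_surj l y
    have := h x y
    simp only [hα', hu', hv', LinearMap.comp_apply, AlgHom.toLinearMap_apply, map_mul] at this
    exact this
  refine LinearMap.ext fun x => ?_
  have h1 : ∑ j ∈ (ℛ k x).index, q l ((ℛ k x).left j) * q' l ((ℛ k x).right j) =
      algebraMap k _ (counit (R := k) x) := by
    have := (ℛ k x).convMul_apply (toConv (q l)) (toConv (q' l))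
    rw [hqq] at this
    exact this.symm
  have h2 := congrArg α' h1
  rw [map_sum, Algebra.algebraMap_eq_smul_one, map_smul] at h2
  simp only [hmul] at h2
  rw [LinearMap.sum_apply]
  simp only [hu', hv', hΓ, hΓ', conv_apply]
  rw [Finset.sum_comm]
  refine h2.trans ?_
  rw [hα']
  simp only [LinearMap.smul_apply, smul_eq_mul, LinearMap.comp_apply, AlgHom.toLinearMap_apply,
    mkB_one, Paper.convOne]
  exact mul_comm _ _

lemma Gamma_mulRight (p : ∀ l, H →ₗ[k] Bq k A l)
    (Γ : Module.Dual k A →ₗ[k] Module.Dual k H)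
    (hΓ : ∀ l (β : Module.Dual k (Bq k A l)), Γ (β ∘ₗ (mkB k A l).toLinearMap) = β ∘ₗ p l)
    (l : ℕ) (β : Module.Dual k (Bq k A l)) (h : H) (a : A) :
    Γ ((β ∘ₗ (mkB k A l).toLinearMap) ∘ₗ LinearMap.mulRight k a) h = β (p l h * mkB k A l a) := by
  have : (β ∘ₗ (mkB k A l).toLinearMap) ∘ₗ LinearMap.mulRight k a =
      (β ∘ₗ LinearMap.mulRight k (mkB k A l a)) ∘ₗ (mkB k A l).toLinearMap := by
    ext x
    simp only [LinearMap.comp_apply, AlgHom.toLinearMap_apply, LinearMap.mulRight_apply, map_mul]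
  rw [this, hΓ]
  rfl

lemma colin (hC : CommByFinite k A H ι) (p : ∀ l, H →ₗ[k] Bq k A l)
    (hp1 : ∀ l h a, p l (h * ι a) = p l h * mkB k A l a)
    (Γ : Module.Dual k A →ₗ[k] Module.Dual k H)
    (hΓ : ∀ l (β : Module.Dual k (Bq k A l)), Γ (β ∘ₗ (mkB k A l).toLinearMap) = β ∘ₗ p l)
    (t : Module.Dual k H) (ht : ∀ h a, t (h * ι a) = counit (R := k) a * t h)
    (l : ℕ) (β : Module.Dual k (Bq k A l)) (h : H) (a : A) :
    conv k t (Γ (β ∘ₗ (mkB k A l).toLinearMap)) (h * ι a) =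
      conv k t (Γ ((β ∘ₗ (mkB k A l).toLinearMap) ∘ₗ LinearMap.mulRight k a)) h := by
  rw [conv_iota hC, conv_apply]
  refine Finset.sum_congr rfl fun i _ => ?_
  rw [Gamma_mulRight p Γ hΓ, hΓ]
  conv_rhs => rw [← sum_counit_smul (R := k) (ℛ k a)]
  simp only [ht, hp1, LinearMap.comp_apply, map_sum, map_smul, Finset.mul_sum, mul_smul_comm,
    smul_eq_mul]
  refine Finset.sum_congr rfl fun j _ => by ring

/-- the map to endomorphisms -/
noncomputable def toEnd {B : Type} [CommRing B] [Algebra k B] (p : H →ₗ[k] B) :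
    WithConv (H →ₗ[k] Module.End k B) :=
  toConv ((Algebra.lmul k B).toLinearMap ∘ₗ p)

lemma toEnd_apply {B : Type} [CommRing B] [Algebra k B] (p : H →ₗ[k] B) (h : H) (b : B) :
    toEnd p h b = p h * b := rfl

lemma toEnd_mul {B : Type} [CommRing B] [Algebra k B] (p q : H →ₗ[k] B)
    (hpq : toConv p * toConv q = 1) : toEnd p * toEnd q = 1 := by
  have := LinearMap.algHom_comp_convMul_distrib (Algebra.lmul k B) (toConv p) (toConv q)
  rw [hpq] at this
  apply WithConv.ext
  refine this.symm.trans (LinearMap.ext fun h => ?_)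
  exact (Algebra.lmul k B).commutes _

lemma surj (hC : CommByFinite k A H ι) (p p' : ∀ l, H →ₗ[k] Bq k A l)
    (hpp : ∀ l, toConv (p' l) * toConv (p l) = 1)
    (hp' : ∀ l h a, p' l (h * ι a) = p' l h * mkB k A l (HopfAlgebra.antipode k a))
    (Γ : Module.Dual k A →ₗ[k] Module.Dual k H)
    (hΓ : ∀ l (β : Module.Dual k (Bq k A l)), Γ (β ∘ₗ (mkB k A l).toLinearMap) = β ∘ₗ p l)
    (f : Module.Dual k H) (l : ℕ) (hl : 0 < l) (hf : U ι l ≤ LinearMap.ker f) :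
    ∃ (n : ℕ) (t : Fin n → Module.Dual k H) (β : Fin n → Module.Dual k (Bq k A l)),
      (∀ i h a, t i (h * ι a) = counit (R := k) a * t i h) ∧
        f = ∑ i, conv k (t i) (Γ (β i ∘ₗ (mkB k A l).toLinearMap)) := by
  obtain ⟨σ, hσ⟩ := LinearMap.exists_rightInverse_of_surjective (mkB k A l).toLinearMap
    (LinearMap.range_eq_top.2 (mkB_surj l))
  have hσ' : ∀ x, mkB k A l (σ x) = x := fun x => LinearMap.congr_fun hσ x
  have hfσ : ∀ h a b, mkB k A l a = mkB k A l b → f (h * ι a) = f (h * ι b) := by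
    intro h a b hab
    rw [← sub_eq_zero, ← map_sub, mkB_zero] at hab
    have := hf (mem_U h hab)
    rw [LinearMap.mem_ker, map_sub, mul_sub, map_sub, sub_eq_zero] at this
    exact this
  obtain ⟨ε, hε⟩ := counitB (k := k) (A := A) l hl
  let F0 : H →ₗ[k] Module.End k (Bq k A l) :=
    LinearMap.mk₂ k (fun h b => f (h * ι (σ b)) • (1 : Bq k A l))
      (fun x y b => by rw [add_mul, map_add, add_smul])
      (fun c x b => by rw [smul_mul_assoc, map_smul, smul_eq_mul, mul_smul])
      (fun x b c => by rw [map_add, map_add, mul_add, map_add, add_smul])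
      (fun c x b => by rw [map_smul, map_smul, mul_smul_comm, map_smul, smul_eq_mul, mul_smul])
  let F : WithConv (H →ₗ[k] Module.End k (Bq k A l)) := toConv F0
  have hF : ∀ h b, F h b = f (h * ι (σ b)) • (1 : Bq k A l) := fun h b => rfl
  have hFi : ∀ h a, F (h * ι a) = F h * Algebra.lmul k _ (mkB k A l a) := by
    intro h a
    refine LinearMap.ext fun b => ?_
    rw [Module.End.mul_apply, hF, hF, mul_assoc, ← hC.ι_mul,
      hfσ h (a * σ b) (σ ((Algebra.lmul k _ (mkB k A l a)) b))]
    rw [hσ', map_mul, hσ']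
    rfl
  let L := F * toEnd (p' l)
  have hLP : L * toEnd (p l) = F := by
    rw [mul_assoc, toEnd_mul _ _ (hpp l), mul_one]
  have hPi : ∀ h a, toEnd (p' l) (h * ι a) = toEnd (p' l) h *
      Algebra.lmul k _ (mkB k A l (HopfAlgebra.antipode k a)) := by
    intro h a
    refine LinearMap.ext fun b => ?_
    rw [Module.End.mul_apply, toEnd_apply, toEnd_apply, hp', mul_assoc]
    rfl
  have hPc : ∀ h x, toEnd (p' l) h * Algebra.lmul k _ x =
      Algebra.lmul k _ x * toEnd (p' l) h := by
    intro h x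
    change Algebra.lmul k _ (p' l h) * Algebra.lmul k _ x =
      Algebra.lmul k _ x * Algebra.lmul k _ (p' l h)
    rw [← map_mul, ← map_mul, mul_comm]
  have hLi : ∀ h a, L (h * ι a) = counit (R := k) a • L h := by
    intro h a
    rw [convMul_iota hC, (ℛ k h).convMul_apply, Finset.smul_sum]
    refine Finset.sum_congr rfl fun i _ => ?_
    have e : ∑ j ∈ (ℛ k a).index, Algebra.lmul k (Bq k A l) (mkB k A l ((ℛ k a).left j)) *
        Algebra.lmul k (Bq k A l) (mkB k A l (HopfAlgebra.antipode k ((ℛ k a).right j))) =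
        algebraMap k _ (counit (R := k) a) := by
      simp only [← map_mul]
      rw [← map_sum, ← map_sum, HopfAlgebra.sum_mul_antipode_eq_algebraMap_counit,
        AlgHom.commutes, AlgHom.commutes]
    have e2 : ∀ j, F ((ℛ k h).left i * ι ((ℛ k a).left j)) *
        toEnd (p' l) ((ℛ k h).right i * ι ((ℛ k a).right j)) =
        F ((ℛ k h).left i) * ((Algebra.lmul k (Bq k A l) (mkB k A l ((ℛ k a).left j)) *
        Algebra.lmul k (Bq k A l) (mkB k A l (HopfAlgebra.antipode k ((ℛ k a).right j)))) *
          toEnd (p' l) ((ℛ k h).right i)) := by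
      intro j
      rw [hFi, hPi, hPc]
      simp only [mul_assoc]
    simp only [e2]
    rw [← Finset.mul_sum, ← Finset.sum_mul, e, ← Algebra.smul_def, mul_smul_comm]
  have := finite_quot_pow hC l
  let bs := Module.finBasis k (Bq k A l)
  refine ⟨Module.finrank k (Bq k A l),
    fun j => ε ∘ₗ LinearMap.applyₗ (bs j) ∘ₗ L.ofConv, fun j => bs.coord j, ?_, ?_⟩
  · intro j h a
    change ε (L (h * ι a) (bs j)) = _ * ε (L h (bs j))
    rw [hLi, LinearMap.smul_apply, map_smul, smul_eq_mul]
  · refine LinearMap.ext fun h => ?_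
    have h1 : f h = ε (F h 1) := by
      rw [hF, map_smul, hε, hfσ h (σ 1) 1 (by rw [hσ', map_one (mkB k A l)]), hC.ι_one, mul_one,
        smul_eq_mul, mul_one]
    rw [h1, ← hLP, (ℛ k h).convMul_apply, LinearMap.sum_apply, map_sum, LinearMap.sum_apply]
    simp only [hΓ, conv_apply]
    rw [Finset.sum_comm]
    refine Finset.sum_congr rfl fun i _ => ?_
    rw [Module.End.mul_apply, toEnd_apply, mul_one]
    conv_lhs => rw [← bs.sum_repr (p l ((ℛ k h).right i)), map_sum, map_sum]
    refine Finset.sum_congr rfl fun j _ => ?_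
    rw [map_smul, map_smul, smul_eq_mul, mul_comm]
    rfl

lemma inj (hC : CommByFinite k A H ι) (p p' : ∀ l, H →ₗ[k] Bq k A l)
    (hp1 : ∀ l h a, p l (h * ι a) = p l h * mkB k A l a)
    (hpp : ∀ l, toConv (p l) * toConv (p' l) = 1)
    (Γ : Module.Dual k A →ₗ[k] Module.Dual k H)
    (hΓ : ∀ l (β : Module.Dual k (Bq k A l)), Γ (β ∘ₗ (mkB k A l).toLinearMap) = β ∘ₗ p l)
    (l : ℕ) (hl : 0 < l) (n : ℕ) (t : Fin n → Module.Dual k H)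
    (β : Fin n → Module.Dual k (Bq k A l))
    (ht : ∀ i h a, t i (h * ι a) = counit (R := k) a * t i h)
    (h0 : ∑ i, conv k (t i) (Γ (β i ∘ₗ (mkB k A l).toLinearMap)) = 0) (h : H) :
    ∑ i, t i h • β i = 0 := by
  obtain ⟨ε, hε⟩ := counitB (k := k) (A := A) l hl
  let G0 : H →ₗ[k] Module.End k (Bq k A l) :=
    ∑ i, (t i).smulRight ((β i).smulRight (1 : Bq k A l))
  let G : WithConv (H →ₗ[k] Module.End k (Bq k A l)) := toConv G0
  have hG : ∀ h b, G h b = (∑ i, t i h * β i b) • (1 : Bq k A l) := by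
    intro h b
    change G0 h b = _
    simp [G0, LinearMap.sum_apply, Finset.sum_smul, mul_smul]
  have hGP : G * toEnd (p l) = 0 := by
    apply WithConv.ext
    refine LinearMap.ext fun x => LinearMap.ext fun b => ?_
    obtain ⟨a, rfl⟩ := mkB_surj l b
    change (G * toEnd (p l)) x (mkB k A l a) = 0
    rw [(ℛ k x).convMul_apply, LinearMap.sum_apply]
    simp only [Module.End.mul_apply, toEnd_apply, hG]
    rw [← Finset.sum_smul, Finset.sum_comm]
    have h1 := LinearMap.congr_fun h0 (x * ι a)
    rw [LinearMap.sum_apply, LinearMap.zero_apply] at h1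
    have h2 : ∀ i, conv k (t i) (Γ (β i ∘ₗ (mkB k A l).toLinearMap)) (x * ι a) =
        ∑ j ∈ (ℛ k x).index, t i ((ℛ k x).left j) *
          β i (p l ((ℛ k x).right j) * mkB k A l a) := by
      intro i
      rw [colin hC p hp1 Γ hΓ (t i) (ht i), conv_apply]
      simp only [Gamma_mulRight p Γ hΓ]
    simp only [h2] at h1
    rw [h1, zero_smul]
  have hG0 : G = 0 := by
    rw [← mul_one G, ← toEnd_mul _ _ (hpp l), ← mul_assoc, hGP, zero_mul]
  refine LinearMap.ext fun b => ?_
  have h1 : G h b = 0 := by rw [hG0]; rfl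
  have h2 := congrArg ε h1
  rw [hG, map_smul, hε, map_zero, smul_eq_mul, mul_one] at h2
  rw [LinearMap.sum_apply]
  exact h2

end
end PaperAux

open Paper in
/-- `W(H°)` decomposes as a crossed product
`W(H°) ≅ H̄* #_σ A'` as algebras, left `H̄*`-modules and right `A'`-comodules;
moreover the coinvariants of `W(H°)` under (the restriction of) `ι°` equal
`H̄*`. The crossed product structure is expressed by a convolution-invertible
right `A'`-colinear cleaving map `Γ : A' → W(H°)` through which `W(H°)` is
freely spanned by `H̄*`. -/
theorem statement_8
    (k : Type) [Field k] [IsAlgClosed k]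
    (A : Type) [CommRing A] [HopfAlgebra k A]
    (H : Type) [Ring H] [HopfAlgebra k H]
    (ι : A →ₗ[k] H)
    (hCbF : CommByFinite k A H ι)
    (hyp : StandingHyp k A H ι) :
    (∃ Γ : Module.Dual k A →ₗ[k] Module.Dual k H,
      -- `Γ` maps `A'` into `W(H°)` and is a section of `ι°`
      (∀ α ∈ Aprime k A, Γ α ∈ tangential k A H ι) ∧
      (∀ α ∈ Aprime k A, iotaDual k A H ι (Γ α) = α) ∧
      -- `Γ` is a right `A'`-comodule map (pairing form)
      (∀ α ∈ Aprime k A, ∀ (h : H) (a : A),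
        Γ α (h * ι a) = Γ (α ∘ₗ LinearMap.mulRight k a) h) ∧
      -- `Γ` is convolution invertible (so is a cleaving map)
      (∃ Γ' : Module.Dual k A →ₗ[k] Module.Dual k H,
        ∀ α ∈ Aprime k A, ∀ (n : ℕ) (u v : Fin n → Module.Dual k A),
          (∀ i, u i ∈ Aprime k A ∧ v i ∈ Aprime k A) →
          (∀ x y : A, α (x * y) = ∑ i, u i x * v i y) →
          (∑ i, conv k (Γ (u i)) (Γ' (v i))) = α 1 • convOne k ∧
          (∑ i, conv k (Γ' (u i)) (Γ (v i))) = α 1 • convOne k) ∧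
      -- `(t, α) ↦ t * Γ(α)` is surjective from `H̄* ⊗ A'` onto `W(H°)` ...
      (∀ f ∈ tangential k A H ι, ∃ (n : ℕ) (t : Fin n → Module.Dual k H)
          (α : Fin n → Module.Dual k A),
        (∀ i, t i ∈ finDual k H ∩ hbarStar k A H ι ∧ α i ∈ Aprime k A) ∧
        f = ∑ i, conv k (t i) (Γ (α i))) ∧
      -- ... and injective ...
      (∀ (n : ℕ) (t : Fin n → Module.Dual k H) (α : Fin n → Module.Dual k A),
        (∀ i, t i ∈ finDual k H ∩ hbarStar k A H ι ∧ α i ∈ Aprime k A) →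
        LinearIndependent k α →
        (∑ i, conv k (t i) (Γ (α i))) = 0 → ∀ i, t i = 0) ∧
      -- ... it is left `H̄*`-linear ...
      (∀ t' ∈ finDual k H ∩ hbarStar k A H ι, ∀ t ∈ finDual k H ∩ hbarStar k A H ι, ∀ α ∈ Aprime k A,
        conv k t' (conv k t (Γ α)) = conv k (conv k t' t) (Γ α)) ∧
      -- ... and right `A'`-colinear (pairing form)
      (∀ t ∈ finDual k H ∩ hbarStar k A H ι, ∀ α ∈ Aprime k A, ∀ (h : H) (a : A),
        conv k t (Γ α) (h * ι a) = conv k t (Γ (α ∘ₗ LinearMap.mulRight k a)) h)) ∧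
    -- the `ι°`-coinvariants of `W(H°)` equal `H̄*`
    {f ∈ tangential k A H ι | ∀ (h : H) (a : A),
        f (h * ι a) = Coalgebra.counit (R := k) a * f h}
      = finDual k H ∩ hbarStar k A H ι := by
  obtain ⟨p, hp1, hp2, hp3, hp4⟩ := PaperAux.exists_proj hCbF
  obtain ⟨p', hpp, hpp', hp3', hp1'⟩ := PaperAux.exists_inv hCbF p hp1 hp3 hp4
  obtain ⟨Γ, hΓ⟩ := PaperAux.exists_Gamma p hp3
  obtain ⟨Γ', hΓ'⟩ := PaperAux.exists_Gamma p' hp3'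
  have lift : ∀ α ∈ Aprime k A, ∃ l, 0 < l ∧ ∃ β : Module.Dual k (PaperAux.Bq k A l),
      α = β ∘ₗ (PaperAux.mkB k A l).toLinearMap := by
    rintro α ⟨n, hn, h⟩
    obtain ⟨β, hβ⟩ := PaperAux.dual_lift h le_rfl
    exact ⟨n, hn, β, hβ⟩
  have hcoinv : ∀ t ∈ finDual k H ∩ hbarStar k A H ι, ∀ h a,
      t (h * ι a) = Coalgebra.counit (R := k) a * t h := fun t ht =>
    (PaperAux.kill_iff hCbF t).1 ((PaperAux.hbar_iff hCbF t).1 ht.2)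
  refine ⟨⟨Γ, ?_, ?_, ?_, ⟨Γ', ?_⟩, ?_, ?_, ?_, ?_⟩, PaperAux.coinv hCbF⟩
  · intro α hα
    obtain ⟨l, hl, β, rfl⟩ := lift α hα
    rw [hΓ]
    have hU : PaperAux.U ι l ≤ LinearMap.ker (β ∘ₗ p l) := by
      rw [PaperAux.U_le_iff]
      intro h a ha
      rw [LinearMap.comp_apply, hp1, PaperAux.mkB_zero.2 ha, mul_zero, map_zero]
    refine ⟨PaperAux.finDual_of_U hCbF l _ hU, l, hl, ?_⟩
    obtain ⟨m, rfl⟩ : ∃ m, l = m + 1 := ⟨l - 1, by omega⟩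
    intro x hx
    rw [PaperAux.U_pow hCbF] at hx
    exact hU hx
  · intro α hα
    obtain ⟨l, hl, β, rfl⟩ := lift α hα
    unfold iotaDual
    rw [hΓ]
    refine LinearMap.ext fun a => ?_
    have := hp1 l 1 a
    rw [one_mul, hp2, one_mul] at this
    exact congrArg β this
  · intro α hα h a
    obtain ⟨l, hl, β, rfl⟩ := lift α hα
    rw [PaperAux.Gamma_mulRight p Γ hΓ, hΓ, LinearMap.comp_apply, hp1]
  · intro α hα n u v huv h
    exact ⟨PaperAux.conv_inv_aux p p' hpp Γ Γ' hΓ hΓ' α hα n u v huv h,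
      PaperAux.conv_inv_aux p' p hpp' Γ' Γ hΓ' hΓ α hα n u v huv h⟩
  · rintro f ⟨-, l, hl, hf⟩
    have hU : PaperAux.U ι l ≤ LinearMap.ker f := by
      obtain ⟨m, rfl⟩ : ∃ m, l = m + 1 := ⟨l - 1, by omega⟩
      rw [← PaperAux.U_pow hCbF]
      exact hf
    obtain ⟨n, t, β, ht, hfs⟩ := PaperAux.surj hCbF p p' hpp' hp1' Γ hΓ f l hl hU
    refine ⟨n, t, fun i => β i ∘ₗ (PaperAux.mkB k A l).toLinearMap, fun i => ⟨?_, l, hl, ?_⟩, hfs⟩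
    · have hk := (PaperAux.kill_iff hCbF (t i)).2 (ht i)
      exact ⟨PaperAux.finDual_of_U hCbF 1 _ hk, (PaperAux.hbar_iff hCbF _).2 hk⟩
    · intro x hx
      rw [LinearMap.comp_apply, AlgHom.toLinearMap_apply, PaperAux.mkB_zero.2 hx, map_zero]
  · intro n t α htα hli h0 i
    choose b hb using fun i => (htα i).2
    let l := 1 + ∑ i, b i
    have hbl : ∀ i, b i ≤ l := fun i => by
      have := Finset.single_le_sum (f := b) (fun _ _ => Nat.zero_le _) (Finset.mem_univ i)
      omega
    choose β hβ using fun i => PaperAux.dual_lift (hb i).2 (hbl i)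
    have h0' : ∑ i, conv k (t i) (Γ (β i ∘ₗ (PaperAux.mkB k A l).toLinearMap)) = 0 := by
      rw [← h0]
      exact Finset.sum_congr rfl fun i _ => by rw [← hβ]
    refine LinearMap.ext fun h => ?_
    have h1 := PaperAux.inj hCbF p p' hp1 hpp Γ hΓ l (by omega) n t β
      (fun i => hcoinv _ (htα i).1) h0' h
    have h2 : ∑ i, t i h • α i = 0 := by
      refine LinearMap.ext fun a => ?_
      have h3 := LinearMap.congr_fun h1 (PaperAux.mkB k A l a)
      rw [LinearMap.sum_apply] at h3 ⊢
      rw [LinearMap.zero_apply] at h3 ⊢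
      rw [← h3]
      refine Finset.sum_congr rfl fun j _ => ?_
      rw [LinearMap.smul_apply, LinearMap.smul_apply]
      congr 1
      exact LinearMap.congr_fun (hβ j) a
    exact Fintype.linearIndependent_iff.1 hli _ h2 i
  · intro t' _ t _ α _
    exact PaperAux.conv_assoc _ _ _
  · intro t ht α hα h a
    obtain ⟨l, hl, β, rfl⟩ := lift α hα
    exact PaperAux.colin hCbF p hp1 Γ hΓ t (hcoinv t ht) l β h a
end
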